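/- arXiv:1807.10098 — 2 statements merged into one kernel-verified Lean document; each statement's English description precedes it below -/
import Mathlib

section
/- As γ → +∞ we have |log β_γ| = o(γ²), i.e. γ^{−2} log β_γ → 0. -/
open Real Set Filter MeasureTheory Topology

noncomputable section

/-- The radial Laplacian with the sign convention Δ = −div(∇·):
for a radial C² function, (Δu)(r) = −u''(r) − u'(r)/r. -/
def radLap (u : ℝ → ℝ) (r : ℝ) : ℝ := -(deriv (deriv u) r) - deriv u r / r

/-- `EigenCtx lam1 v1` : λ₁ > 0 is the first radial Dirichlet eigenvalue of Δ = −div∇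
on the unit disk, with radial eigenfunction v₁: v₁ smooth on [0,1], Δv₁ = λ₁v₁ in Ω,
v₁ > 0 in Ω, v₁(1) = 0 and ∫_Ω v₁² dy = ∫₀¹ v₁(r)² 2πr dr = 1. -/
def EigenCtx (lam1 : ℝ) (v1 : ℝ → ℝ) : Prop :=
  0 < lam1 ∧ ContDiffOn ℝ (⊤ : ℕ∞) v1 (Set.Icc 0 1) ∧
    (∀ r ∈ Set.Ioo (0:ℝ) 1, radLap v1 r = lam1 * v1 r) ∧
    (∀ r ∈ Set.Ico (0:ℝ) 1, 0 < v1 r) ∧ v1 1 = 0 ∧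
    (∫ r in Set.Ioo (0:ℝ) 1, (v1 r) ^ 2 * (2 * π * r)) = 1

/-- `IsRadSol lam beta gam u` : u is a smooth radial function on the closed unit disk,
positive in the open disk, vanishing on the boundary, with central value γ, solving
Δu = λu + βu e^{u²} in Ω (radially). -/
def IsRadSol (lam beta gam : ℝ) (u : ℝ → ℝ) : Prop :=
  ContDiffOn ℝ (⊤ : ℕ∞) u (Set.Icc 0 1) ∧
    (∀ r ∈ Set.Ioo (0:ℝ) 1,
      radLap u r = lam * u r + beta * u r * Real.exp ((u r) ^ 2)) ∧
    (∀ r ∈ Set.Ico (0:ℝ) 1, 0 < u r) ∧ u 1 = 0 ∧ u 0 = gam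

/-- λ̄_γ = λ₁ − ε_γ with ε_γ = (4π v₁(0)/γ)√(λ₁/l). -/
def lamBar (lam1 v10 l γ : ℝ) : ℝ := lam1 - 4 * π * v10 / γ * Real.sqrt (lam1 / l)

/-- The family (β_γ, u_γ) of Theorem 1: for every γ > 0 with λ̄_γ > 0, β_γ > 0 and u_γ
is a smooth positive radial solution of Δu = λ̄_γ u + β_γ u e^{u²} with u_γ(0) = γ. -/
def GoodFamily (lam1 : ℝ) (v1 : ℝ → ℝ) (l : ℝ) (β : ℝ → ℝ) (u : ℝ → ℝ → ℝ) : Prop :=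
  ∀ γ : ℝ, 0 < γ → 0 < lamBar lam1 (v1 0) l γ →
    0 < β γ ∧ IsRadSol (lamBar lam1 (v1 0) l γ) (β γ) γ (u γ)

/-- Dirichlet energy ∫_Ω |∇u|² dy of a radial function, = ∫₀¹ u'(r)² 2πr dr. -/
def dirEnergy (u : ℝ → ℝ) : ℝ := ∫ r in Set.Ioo (0:ℝ) 1, (deriv u r) ^ 2 * (2 * π * r)

/-- L² norm ‖u‖_{L²(Ω)} of a radial function. -/
def l2norm (u : ℝ → ℝ) : ℝ := Real.sqrt (∫ r in Set.Ioo (0:ℝ) 1, (u r) ^ 2 * (2 * π * r))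

/-- A continuous function with nonnegative derivative in the interior does not decrease. -/
lemma le_of_hasDerivAt_nonneg {f f' : ℝ → ℝ} {a b : ℝ} (hab : a ≤ b)
    (hc : ContinuousOn f (Icc a b)) (hd : ∀ x ∈ Ioo a b, HasDerivAt f (f' x) x)
    (h0 : ∀ x ∈ Ioo a b, 0 ≤ f' x) : f a ≤ f b := by
  refine monotoneOn_of_deriv_nonneg (convex_Icc a b) hc ?_ ?_
    (left_mem_Icc.2 hab) (right_mem_Icc.2 hab) hab
  · rw [interior_Icc]
    exact fun x hx => (hd x hx).differentiableAt.differentiableWithinAt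
  · rw [interior_Icc]
    intro x hx
    rw [(hd x hx).deriv]
    exact h0 x hx

/-- The derivative of a radial function that is smooth up to the boundary, and the divergence form
of the radial Laplacian. -/
lemma exists_radial_derivative {w : ℝ → ℝ} (hw : ContDiffOn ℝ (⊤ : ℕ∞) w (Icc 0 1)) :
    ∃ p : ℝ → ℝ, ContinuousOn p (Icc 0 1) ∧ ∀ r ∈ Ioo (0 : ℝ) 1, HasDerivAt w (p r) r ∧
      HasDerivAt (fun s => s * p s) (-(r * radLap w r)) r := by
  have hU : UniqueDiffOn ℝ (Icc (0 : ℝ) 1) := uniqueDiffOn_Icc zero_lt_one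
  have hp : ContDiffOn ℝ 1 (derivWithin w (Icc 0 1)) (Icc 0 1) :=
    hw.derivWithin hU (by norm_cast)
  refine ⟨derivWithin w (Icc 0 1), hp.continuousOn, fun r hr => ?_⟩
  have hnhds : ∀ s ∈ Ioo (0 : ℝ) 1, Icc (0 : ℝ) 1 ∈ 𝓝 s := fun s hs => Icc_mem_nhds hs.1 hs.2
  have hdw : ∀ s ∈ Ioo (0 : ℝ) 1, derivWithin w (Icc 0 1) s = deriv w s := fun s hs =>
    derivWithin_of_mem_nhds (hnhds s hs)
  have hev : derivWithin w (Icc 0 1) =ᶠ[𝓝 r] deriv w := by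
    filter_upwards [isOpen_Ioo.mem_nhds hr] with s hs using hdw s hs
  have hwd : DifferentiableAt ℝ w r :=
    (hw.contDiffAt (hnhds r hr)).differentiableAt (by simp)
  have hpd : DifferentiableAt ℝ (derivWithin w (Icc 0 1)) r :=
    (hp.contDiffAt (hnhds r hr)).differentiableAt (by simp)
  refine ⟨?_, ?_⟩
  · rw [hdw r hr]
    exact hwd.hasDerivAt
  · have h := (hasDerivAt_id r).mul hpd.hasDerivAt
    have hr0 : r ≠ 0 := hr.1.ne'
    refine h.congr_deriv ?_
    rw [hev.deriv_eq, hdw r hr, radLap]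
    simp only [id]
    field_simp
    ring

/-- The integrated form of the radial equation: the flux `-r u'` splits as `L + M`, where `L` and
`M` are the masses (up to the factor `2π`) of the linear and of the exponential term. -/
structure RadialFlux (lam beta gam : ℝ) (u L M : ℝ → ℝ) : Prop where
  lam_pos : 0 < lam
  beta_pos : 0 < beta
  u_cont : ContinuousOn u (Icc 0 1)
  L_cont : ContinuousOn L (Icc 0 1)
  M_cont : ContinuousOn M (Icc 0 1)
  u_zero : u 0 = gam
  u_one : u 1 = 0
  u_pos : ∀ r ∈ Ico (0 : ℝ) 1, 0 < u r
  L_zero : L 0 = 0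
  M_zero : M 0 = 0
  L_deriv : ∀ r ∈ Ioo (0 : ℝ) 1, HasDerivAt L (lam * r * u r) r
  M_deriv : ∀ r ∈ Ioo (0 : ℝ) 1, HasDerivAt M (r * (beta * u r * exp (u r ^ 2))) r
  u_deriv : ∀ r ∈ Ioo (0 : ℝ) 1, HasDerivAt u (-((L r + M r) / r)) r

lemma IsRadSol.exists_radialFlux {lam beta gam : ℝ} {u : ℝ → ℝ} (hlam : 0 < lam)
    (hbeta : 0 < beta) (h : IsRadSol lam beta gam u) :
    ∃ L M, RadialFlux lam beta gam u L M := by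
  obtain ⟨hsm, hode, hpos, h1, h0⟩ := h
  obtain ⟨p, hpc, hp⟩ := exists_radial_derivative hsm
  have huc := hsm.continuousOn
  have hgc : ContinuousOn (fun s => lam * s * u s) (Icc 0 1) := by fun_prop
  have hint : IntegrableOn (fun s => lam * s * u s) (Icc 0 1) := hgc.integrableOn_Icc
  have hLd : ∀ r ∈ Ioo (0 : ℝ) 1,
      HasDerivAt (fun r => ∫ s in (0 : ℝ)..r, lam * s * u s) (lam * r * u r) r := by
    intro r hr
    have hn : Icc (0 : ℝ) 1 ∈ 𝓝 r := Icc_mem_nhds hr.1 hr.2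
    refine intervalIntegral.integral_hasDerivAt_right ?_ ?_ (hgc.continuousAt hn)
    · refine (hgc.mono ?_).intervalIntegrable
      rw [uIcc_of_le hr.1.le]
      exact Icc_subset_Icc_right hr.2.le
    · exact hgc.stronglyMeasurableAtFilter_nhdsWithin measurableSet_Icc r |>.filter_mono
        (by rw [nhdsWithin_eq_nhds.2 hn])
  have hLc : ContinuousOn (fun r => ∫ s in (0 : ℝ)..r, lam * s * u s) (Icc 0 1) :=
    intervalIntegral.continuousOn_primitive_interval (by rwa [uIcc_of_le zero_le_one])
      |>.mono (by rw [uIcc_of_le zero_le_one])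
  refine ⟨fun r => ∫ s in (0 : ℝ)..r, lam * s * u s,
    fun r => -(r * p r) - ∫ s in (0 : ℝ)..r, lam * s * u s,
    hlam, hbeta, huc, hLc, by fun_prop, h0, h1, hpos, by simp, by simp, hLd, ?_, ?_⟩
  · intro r hr
    refine ((hp r hr).2.neg.sub (hLd r hr)).congr_deriv ?_
    rw [hode r hr]
    ring
  · intro r hr
    refine (hp r hr).1.congr_deriv ?_
    have := hr.1.ne'
    field_simp
    ring

namespace RadialFlux

variable {lam beta gam : ℝ} {u L M : ℝ → ℝ}

lemma L_mono (h : RadialFlux lam beta gam u L M) {a b : ℝ} (ha : 0 ≤ a) (hab : a ≤ b)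
    (hb : b ≤ 1) : L a ≤ L b :=
  le_of_hasDerivAt_nonneg hab (h.L_cont.mono (Icc_subset_Icc ha hb))
    (fun x hx => h.L_deriv x (Ioo_subset_Ioo ha hb hx)) fun x hx => by
      have hx' := Ioo_subset_Ioo ha hb hx
      have := h.u_pos x ⟨hx'.1.le, hx'.2⟩
      have := h.lam_pos
      have := hx'.1
      positivity

lemma M_mono (h : RadialFlux lam beta gam u L M) {a b : ℝ} (ha : 0 ≤ a) (hab : a ≤ b)
    (hb : b ≤ 1) : M a ≤ M b :=
  le_of_hasDerivAt_nonneg hab (h.M_cont.mono (Icc_subset_Icc ha hb))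
    (fun x hx => h.M_deriv x (Ioo_subset_Ioo ha hb hx)) fun x hx => by
      have hx' := Ioo_subset_Ioo ha hb hx
      have := h.u_pos x ⟨hx'.1.le, hx'.2⟩
      have := h.beta_pos
      have := hx'.1
      positivity

lemma L_nonneg (h : RadialFlux lam beta gam u L M) {r : ℝ} (h0 : 0 ≤ r) (h1 : r ≤ 1) :
    0 ≤ L r := by
  simpa [h.L_zero] using h.L_mono le_rfl h0 h1

lemma M_nonneg (h : RadialFlux lam beta gam u L M) {r : ℝ} (h0 : 0 ≤ r) (h1 : r ≤ 1) :
    0 ≤ M r := by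
  simpa [h.M_zero] using h.M_mono le_rfl h0 h1

lemma u_anti (h : RadialFlux lam beta gam u L M) {a b : ℝ} (ha : 0 ≤ a) (hab : a ≤ b)
    (hb : b ≤ 1) : u b ≤ u a := by
  have := le_of_hasDerivAt_nonneg hab (h.u_cont.mono (Icc_subset_Icc ha hb)).neg
    (fun x hx => (h.u_deriv x (Ioo_subset_Ioo ha hb hx)).neg) fun x hx => by
      have hx' := Ioo_subset_Ioo ha hb hx
      have := h.L_nonneg hx'.1.le hx'.2.le
      have := h.M_nonneg hx'.1.le hx'.2.le
      have := hx'.1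
      rw [neg_neg]
      positivity
  simpa using this

lemma u_le (h : RadialFlux lam beta gam u L M) {r : ℝ} (h0 : 0 ≤ r) (h1 : r ≤ 1) :
    u r ≤ gam := by
  simpa [h.u_zero] using h.u_anti le_rfl h0 h1

lemma gam_pos (h : RadialFlux lam beta gam u L M) : 0 < gam := by
  simpa [h.u_zero] using h.u_pos 0 (by simp)

/-- A Pohozaev-type inequality. -/
lemma M_mul_u_le_two (h : RadialFlux lam beta gam u L M) {a : ℝ} (ha : a ∈ Ioo (0 : ℝ) 1) :
    M a * u a ≤ 2 := by
  have hua := h.u_pos a ⟨ha.1.le, ha.2⟩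
  have hss : Icc 0 a ⊆ Icc (0 : ℝ) 1 := Icc_subset_Icc_right ha.2.le
  have hMc := h.M_cont.mono hss
  have huc := h.u_cont.mono hss
  have key := le_of_hasDerivAt_nonneg
    (f := fun r => 2 / u a * M r - M r ^ 2 - beta * (r ^ 2 * exp (u r ^ 2)))
    (f' := fun r => 2 * (r * beta * exp (u r ^ 2)) * ((u r / u a - 1) + L r * u r)) ha.1.le
    (by fun_prop)
    (fun x hx => by
      have hx' : x ∈ Ioo (0 : ℝ) 1 := ⟨hx.1, hx.2.trans ha.2⟩
      have hx0 := hx.1.ne'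
      have hM := h.M_deriv x hx'
      have hu := h.u_deriv x hx'
      refine (((hM.const_mul (2 / u a)).sub (hM.pow 2)).sub
        ((((hasDerivAt_id x).pow 2).mul (hu.pow 2).exp).const_mul beta)).congr_deriv ?_
      simp only [id, Pi.pow_apply]
      field_simp
      push_cast
      ring)
    (fun x hx => by
      have hx1 : x < 1 := hx.2.trans ha.2
      have h1 : 1 ≤ u x / u a := (one_le_div hua).2 (h.u_anti hx.1.le hx.2.le ha.2.le)
      have h2 := h.L_nonneg hx.1.le hx1.le
      have h3 := h.u_pos x ⟨hx.1.le, hx1⟩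
      have h4 := h.beta_pos
      have h5 := hx.1
      have h6 : 0 ≤ u x / u a - 1 := by linarith
      positivity)
  simp only [h.M_zero] at key
  have hM0 := h.M_nonneg ha.1.le ha.2.le
  have hQ : 0 ≤ beta * (a ^ 2 * exp (u a ^ 2)) := by
    have := h.beta_pos
    positivity
  have hle : M a ^ 2 ≤ 2 / u a * M a := by
    norm_num at key
    linarith
  by_contra hcon
  push Not at hcon
  have hMpos : 0 < M a := by
    by_contra h'
    have : M a = 0 := le_antisymm (not_lt.1 h') hM0
    rw [this] at hcon
    linarith
  have : M a ≤ 2 / u a := by nlinarith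
  rw [le_div_iff₀ hua] at this
  linarith

/-- Growth of the exponential mass where the rescaled density `r² β exp (u²)` is small. -/
lemma M_one_le (h : RadialFlux lam beta gam u L M) {a θ : ℝ} (ha : a ∈ Ioo (0 : ℝ) 1)
    (hθ : ∀ r ∈ Ioo a 1, r ^ 2 * (beta * exp (u r ^ 2)) ≤ θ) :
    M 1 ≤ M a + gam * θ * (-log a) := by
  have hss : Icc a 1 ⊆ Icc (0 : ℝ) 1 := Icc_subset_Icc_left ha.1.le
  have hMc := h.M_cont.mono hss
  have hlog : ContinuousOn log (Icc a 1) :=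
    continuousOn_log.mono fun x hx => (ha.1.trans_le hx.1).ne'
  have key := le_of_hasDerivAt_nonneg (f := fun r => gam * θ * log r - M r)
    (f' := fun r => gam * θ * r⁻¹ - r * (beta * u r * exp (u r ^ 2))) ha.2.le (by fun_prop)
    (fun x hx => ((hasDerivAt_log (ha.1.trans hx.1).ne').const_mul _).sub
      (h.M_deriv x ⟨ha.1.trans hx.1, hx.2⟩))
    (fun x hx => by
      have hx0 := ha.1.trans hx.1
      have hu0 := h.u_pos x ⟨hx0.le, hx.2⟩
      have hug := h.u_le hx0.le hx.2.le
      have hQ := hθ x hx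
      have hQ0 : 0 ≤ x ^ 2 * (beta * exp (u x ^ 2)) := by
        have := h.beta_pos
        positivity
      have hm : u x * (x ^ 2 * (beta * exp (u x ^ 2))) ≤ gam * θ :=
        mul_le_mul hug hQ hQ0 (hu0.le.trans hug)
      have he : gam * θ * x⁻¹ - x * (beta * u x * exp (u x ^ 2)) =
          (gam * θ - u x * (x ^ 2 * (beta * exp (u x ^ 2)))) * x⁻¹ := by
        field_simp
      rw [he]
      exact mul_nonneg (by linarith) (by positivity))
  simp only [log_one] at key
  linarith

lemma L_le_sq (h : RadialFlux lam beta gam u L M) {r : ℝ} (h0 : 0 ≤ r) (h1 : r ≤ 1) :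
    L r ≤ lam * gam * r ^ 2 := by
  have hc := h.L_cont.mono (Icc_subset_Icc_right h1)
  have key := le_of_hasDerivAt_nonneg (f := fun s => lam * gam * s ^ 2 - L s)
    (f' := fun s => lam * gam * (2 * s) - lam * s * u s) h0 (by fun_prop)
    (fun x hx =>
      (((hasDerivAt_pow 2 x).const_mul (lam * gam)).sub
        (h.L_deriv x ⟨hx.1, hx.2.trans_le h1⟩)).congr_deriv (by simp))
    (fun x hx => by
      have hu := h.u_le hx.1.le (hx.2.le.trans h1)
      have hg := h.gam_pos
      have hp : 0 ≤ lam * x := mul_nonneg h.lam_pos.le hx.1.le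
      nlinarith [mul_nonneg hp hg.le, mul_le_mul_of_nonneg_left hu hp])
  simp only [h.L_zero] at key
  linarith

lemma M_le_sq (h : RadialFlux lam beta gam u L M) {r : ℝ} (h0 : 0 ≤ r) (h1 : r ≤ 1) :
    M r ≤ beta * gam * exp (gam ^ 2) * r ^ 2 := by
  have hc := h.M_cont.mono (Icc_subset_Icc_right h1)
  have key := le_of_hasDerivAt_nonneg
    (f := fun s => beta * gam * exp (gam ^ 2) * s ^ 2 - M s)
    (f' := fun s => beta * gam * exp (gam ^ 2) * (2 * s) - s * (beta * u s * exp (u s ^ 2)))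
    h0 (by fun_prop)
    (fun x hx =>
      (((hasDerivAt_pow 2 x).const_mul (beta * gam * exp (gam ^ 2))).sub
        (h.M_deriv x ⟨hx.1, hx.2.trans_le h1⟩)).congr_deriv (by simp))
    (fun x hx => by
      have hu0 := h.u_pos x ⟨hx.1.le, hx.2.trans_le h1⟩
      have hu := h.u_le hx.1.le (hx.2.le.trans h1)
      have hb := h.beta_pos
      have hg := h.gam_pos
      have hx0 := hx.1
      have hm : x * (beta * u x * exp (u x ^ 2)) ≤ x * (beta * gam * exp (gam ^ 2)) := by
        gcongr
      have hp : 0 ≤ x * (beta * gam * exp (gam ^ 2)) := by positivity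
      nlinarith)
  simp only [h.M_zero] at key
  linarith

/-- The total linear mass is controlled by its part in the disk of radius `1/2`. -/
lemma L_one_le (h : RadialFlux lam beta gam u L M) : L 1 ≤ 4 * L (1 / 2) := by
  have hl := h.lam_pos
  have h1 := le_of_hasDerivAt_nonneg (a := 0) (b := 1 / 2)
    (f := fun s => L s - lam * u (1 / 2) / 2 * s ^ 2)
    (f' := fun s => lam * s * u s - lam * u (1 / 2) / 2 * (2 * s)) (by norm_num)
    (by
      have := h.L_cont.mono (Icc_subset_Icc_right (by norm_num : (1 / 2 : ℝ) ≤ 1))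
      fun_prop)
    (fun x hx =>
      ((h.L_deriv x ⟨hx.1, by linarith [hx.2]⟩).sub
        ((hasDerivAt_pow 2 x).const_mul (lam * u (1 / 2) / 2))).congr_deriv (by simp))
    (fun x hx => by
      have hu := h.u_anti hx.1.le hx.2.le (by norm_num)
      nlinarith [mul_le_mul_of_nonneg_left hu (mul_nonneg hl.le hx.1.le)])
  have h2 := le_of_hasDerivAt_nonneg (a := 1 / 2) (b := 1)
    (f := fun s => lam * u (1 / 2) / 2 * s ^ 2 - L s)
    (f' := fun s => lam * u (1 / 2) / 2 * (2 * s) - lam * s * u s) (by norm_num)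
    (by
      have := h.L_cont.mono (Icc_subset_Icc_left (by norm_num : (0 : ℝ) ≤ 1 / 2))
      fun_prop)
    (fun x hx =>
      (((hasDerivAt_pow 2 x).const_mul (lam * u (1 / 2) / 2)).sub
        (h.L_deriv x ⟨by linarith [hx.1], hx.2⟩)).congr_deriv (by simp))
    (fun x hx => by
      have hx0 : 0 ≤ x := by linarith [hx.1]
      have hu := h.u_anti (by norm_num) hx.1.le hx.2.le
      nlinarith [mul_le_mul_of_nonneg_left hu (mul_nonneg hl.le hx0)])
  simp only [h.L_zero] at h1
  norm_num at h1 h2 ⊢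
  linarith

/-- Descent from `u a` to the boundary value `0`. -/
lemma u_le_of_L_le (h : RadialFlux lam beta gam u L M) {a A : ℝ} (ha : a ∈ Ioo (0 : ℝ) 1)
    (hA : 0 ≤ A) (hL : ∀ r ∈ Icc (0 : ℝ) 1, L r ≤ A * r) : u a ≤ A + M 1 * (-log a) := by
  have huc := h.u_cont.mono (Icc_subset_Icc_left ha.1.le)
  have hlog : ContinuousOn log (Icc a 1) :=
    continuousOn_log.mono fun x hx => (ha.1.trans_le hx.1).ne'
  have key := le_of_hasDerivAt_nonneg (f := fun r => u r + A * r + M 1 * log r)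
    (f' := fun r => -((L r + M r) / r) + A * 1 + M 1 * r⁻¹) ha.2.le (by fun_prop)
    (fun x hx => ((h.u_deriv x ⟨ha.1.trans hx.1, hx.2⟩).add
      ((hasDerivAt_id x).const_mul A)).add ((hasDerivAt_log (ha.1.trans hx.1).ne').const_mul _))
    (fun x hx => by
      have hx0 := ha.1.trans hx.1
      have h1 := hL x ⟨hx0.le, hx.2.le⟩
      have h2 := h.M_mono hx0.le hx.2.le le_rfl
      have he : -((L x + M x) / x) + A * 1 + M 1 * x⁻¹ =
          (A * x - L x + (M 1 - M x)) * x⁻¹ := by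
        field_simp
        ring
      rw [he]
      exact mul_nonneg (by linarith) (by positivity))
  simp only [h.u_one, log_one] at key
  nlinarith [mul_nonneg hA ha.1.le]

/-- Lower bound for `u` close to the centre. -/
lemma gam_le (h : RadialFlux lam beta gam u L M) {a A : ℝ} (ha : a ∈ Ioo (0 : ℝ) 1)
    (hL : ∀ r ∈ Icc (0 : ℝ) 1, L r ≤ A * r) :
    gam ≤ u a + (A + beta * gam * exp (gam ^ 2) * a) * a := by
  have huc := h.u_cont.mono (Icc_subset_Icc_right ha.2.le)
  have key := le_of_hasDerivAt_nonneg
    (f := fun r => u r + (A + beta * gam * exp (gam ^ 2) * a) * r)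
    (f' := fun r => -((L r + M r) / r) + (A + beta * gam * exp (gam ^ 2) * a) * 1) ha.1.le
    (by fun_prop)
    (fun x hx => (h.u_deriv x ⟨hx.1, hx.2.trans ha.2⟩).add
      ((hasDerivAt_id x).const_mul _))
    (fun x hx => by
      have hx0 := hx.1
      have hx1 := hx.2.trans ha.2
      have h1 := hL x ⟨hx0.le, hx1.le⟩
      have h2 := h.M_le_sq hx0.le hx1.le
      have h3 : 0 ≤ beta * gam * exp (gam ^ 2) := by
        have := h.beta_pos
        have := h.gam_pos
        positivity
      have h4 : (L x + M x) / x ≤ A + beta * gam * exp (gam ^ 2) * a := by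
        rw [div_le_iff₀ hx0]
        nlinarith [mul_le_mul_of_nonneg_left hx.2.le (mul_nonneg h3 hx0.le)]
      linarith)
  simp only [h.u_zero] at key
  linarith

/-- The last radius, down to `exp (-γ²)`, at which the rescaled density exceeds a threshold. -/
lemma exists_last_radius (h : RadialFlux lam beta gam u L M) {θ : ℝ} (hθ : beta < θ) :
    ∃ a ∈ Ioo (0 : ℝ) 1, exp (-gam ^ 2) ≤ a ∧
      (∀ r ∈ Ioo a 1, r ^ 2 * (beta * exp (u r ^ 2)) ≤ θ) ∧
      (a = exp (-gam ^ 2) ∨ θ ≤ a ^ 2 * (beta * exp (u a ^ 2))) := by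
  have hg := h.gam_pos
  have he0 : 0 < exp (-gam ^ 2) := exp_pos _
  have he1 : exp (-gam ^ 2) < 1 := Real.exp_lt_one_iff.2 (by nlinarith)
  set S := Icc (exp (-gam ^ 2)) 1 ∩ (fun r => r ^ 2 * (beta * exp (u r ^ 2))) ⁻¹' Ici θ
  rcases S.eq_empty_or_nonempty with hemp | hne
  · refine ⟨exp (-gam ^ 2), ⟨he0, he1⟩, le_rfl, fun r hr => ?_, Or.inl rfl⟩
    by_contra hcon
    push Not at hcon
    have : r ∈ S := ⟨⟨hr.1.le, hr.2.le⟩, hcon.le⟩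
    simp [hemp] at this
  · have huc := h.u_cont.mono (Icc_subset_Icc_left he0.le : Icc (exp (-gam ^ 2)) 1 ⊆ Icc 0 1)
    have hclosed : IsClosed S :=
      ContinuousOn.preimage_isClosed_of_isClosed (by fun_prop) isClosed_Icc isClosed_Ici
    obtain ⟨a, haS, ha⟩ :=
      (isCompact_Icc.of_isClosed_subset hclosed inter_subset_left).exists_isGreatest hne
    have ha1 : a ≠ 1 := by
      rintro rfl
      have := haS.2
      simp only [mem_preimage, h.u_one, mem_Ici] at this
      norm_num at this
      linarith
    refine ⟨a, ⟨he0.trans_le haS.1.1, lt_of_le_of_ne haS.1.2 ha1⟩, haS.1.1, fun r hr => ?_,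
      Or.inr haS.2⟩
    by_contra hcon
    push Not at hcon
    exact absurd (ha ⟨⟨haS.1.1.trans hr.1.le, hr.2.le⟩, hcon.le⟩) (not_le.2 hr.1)

/-- If `β` is exponentially small, there is a radius beyond which the exponential mass is almost
constant, and at which `u` is large compared with the logarithm of the radius. -/
lemma exists_concentration_radius (h : RadialFlux lam beta gam u L M) {η : ℝ} (hη : 0 < η)
    (hη1 : η ≤ 1) (hg : 1 ≤ gam) (hb1 : beta ≤ 1) (hb : log beta ≤ -2 * η * gam ^ 2) :
    ∃ a ∈ Ioo (0 : ℝ) 1, -log a ≤ gam ^ 2 ∧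
      ((a = exp (-gam ^ 2) ∧ M 1 ≤ 2 * (gam ^ 3 * exp (-η * gam ^ 2))) ∨
        (η * gam ^ 2 + 2 * (-log a) ≤ u a ^ 2 ∧
          M 1 * u a ≤ 2 + gam ^ 3 * exp (-η * gam ^ 2) * u a)) := by
  have hb0 := h.beta_pos
  have hg2 : 0 < η * gam ^ 2 := by positivity
  have hbθ : beta < exp (-η * gam ^ 2) := by
    rw [← log_lt_iff_lt_exp hb0]
    linarith
  obtain ⟨a, ha, hea, hsmall, hcase⟩ := h.exists_last_radius hbθ
  have hT : -log a ≤ gam ^ 2 := by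
    have := (le_log_iff_exp_le ha.1).2 hea
    linarith
  have hua := h.u_pos a ⟨ha.1.le, ha.2⟩
  have hM1 : M 1 ≤ M a + gam ^ 3 * exp (-η * gam ^ 2) := by
    refine (h.M_one_le ha hsmall).trans ?_
    have : gam * exp (-η * gam ^ 2) * (-log a) ≤ gam * exp (-η * gam ^ 2) * gam ^ 2 := by gcongr
    linarith
  refine ⟨a, ha, hT, ?_⟩
  rcases hcase with hae | hQ
  · refine Or.inl ⟨hae, ?_⟩
    have h1 := h.M_le_sq ha.1.le ha.2.le
    have h2 : exp (gam ^ 2) * a = 1 := by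
      rw [hae, ← exp_add]
      simp
    have h3 : a ≤ exp (-η * gam ^ 2) := by
      rw [hae]
      exact exp_le_exp.2 (by nlinarith)
    have h4 : gam ≤ gam ^ 3 := le_self_pow₀ hg (by norm_num)
    have h5 : M a ≤ gam ^ 3 * exp (-η * gam ^ 2) := calc
      M a ≤ beta * gam * (exp (gam ^ 2) * a) * a := by linarith
      _ = beta * gam * a := by rw [h2, mul_one]
      _ ≤ 1 * gam ^ 3 * exp (-η * gam ^ 2) := by
        have := ha.1.le
        gcongr
      _ = gam ^ 3 * exp (-η * gam ^ 2) := by ring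
    linarith
  · refine Or.inr ⟨?_, ?_⟩
    · have ha0 : a ^ 2 ≠ 0 := pow_ne_zero _ ha.1.ne'
      have := log_le_log (exp_pos _) hQ
      rw [log_exp, log_mul ha0 (by positivity), log_mul hb0.ne' (exp_pos _).ne', log_exp,
        log_pow] at this
      push_cast at this
      linarith
    · nlinarith [h.M_mul_u_le_two ha, mul_le_mul_of_nonneg_right hM1 hua.le]

/-- If `β` is exponentially small, the exponential mass is `O(1/γ)`. -/
lemma M_one_mul_gam_le (h : RadialFlux lam beta gam u L M) {η : ℝ} (hη : 0 < η)
    (hη1 : η ≤ 1) (hg : 1 ≤ gam) (hb1 : beta ≤ 1) (hb : log beta ≤ -2 * η * gam ^ 2)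
    (hsmall : gam ^ 5 * exp (-η * gam ^ 2) ≤ 1) : M 1 * gam ≤ 2 / √η + 2 := by
  have hθ := exp_pos (-η * gam ^ 2)
  have h4 : gam ^ 3 * exp (-η * gam ^ 2) * gam ≤ 1 := by
    have : gam ^ 4 ≤ gam ^ 5 := pow_le_pow_right₀ hg (by norm_num)
    nlinarith
  have hs : 0 < √η := sqrt_pos.2 hη
  obtain ⟨a, ha, -, ⟨-, hM⟩ | ⟨hu, hM⟩⟩ := h.exists_concentration_radius hη hη1 hg hb1 hb
  · have : M 1 * gam ≤ 2 * (gam ^ 3 * exp (-η * gam ^ 2)) * gam := by gcongr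
    have : 0 ≤ 2 / √η := by positivity
    linarith
  · have hua := h.u_pos a ⟨ha.1.le, ha.2⟩
    have hlog := log_neg ha.1 ha.2
    have hle : √η * gam ≤ u a := by
      rw [← pow_le_pow_iff_left₀ (by positivity) hua.le two_ne_zero, mul_pow, sq_sqrt hη.le]
      linarith
    have h1 : (M 1 - gam ^ 3 * exp (-η * gam ^ 2)) * gam ≤ 2 / √η := by
      rw [le_div_iff₀ hs]
      rcases le_total 0 (M 1 - gam ^ 3 * exp (-η * gam ^ 2)) with h0 | h0
      · nlinarith [mul_le_mul_of_nonneg_left hle h0]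
      · nlinarith [mul_nonneg (sub_nonneg.2 h0) (mul_nonneg hs.le (zero_le_one.trans hg))]
    linarith

/-- If `β` is exponentially small, the linear mass must be large. -/
lemma mul_gam_le_of_L_le (h : RadialFlux lam beta gam u L M) {η A : ℝ} (hη : 0 < η)
    (hη1 : η ≤ 1) (hg : 1 ≤ gam) (hb1 : beta ≤ 1) (hb : log beta ≤ -2 * η * gam ^ 2)
    (hA : 0 ≤ A) (hL : ∀ r ∈ Icc (0 : ℝ) 1, L r ≤ A * r) :
    η * gam ≤ 2 * A + 3 * (gam ^ 5 * exp (-η * gam ^ 2)) := by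
  have hθ := exp_pos (-η * gam ^ 2)
  obtain ⟨a, ha, hT, ⟨hae, hM⟩ | ⟨hu, hM⟩⟩ := h.exists_concentration_radius hη hη1 hg hb1 hb
  · have h1 := h.u_le_of_L_le ha hA hL
    have h2 := h.gam_le ha hL
    have h3 : exp (gam ^ 2) * a = 1 := by
      rw [hae, ← exp_add]
      simp
    have h4 : -log a = gam ^ 2 := by
      rw [hae, log_exp]
      ring
    have h5 : a ≤ exp (-η * gam ^ 2) := by
      rw [hae]
      exact exp_le_exp.2 (by nlinarith)
    have h6 : M 1 * (-log a) ≤ 2 * (gam ^ 3 * exp (-η * gam ^ 2)) * gam ^ 2 := by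
      rw [h4]
      gcongr
    have h7 : (A + beta * gam * exp (gam ^ 2) * a) * a = A * a + beta * gam * a := by
      rw [mul_assoc (beta * gam), h3]
      ring
    have h8 : beta * gam * a ≤ 1 * gam ^ 5 * exp (-η * gam ^ 2) := by
      have := ha.1.le
      have : gam ≤ gam ^ 5 := le_self_pow₀ hg (by norm_num)
      have := h.beta_pos
      gcongr
    have h9 : A * a ≤ A := mul_le_of_le_one_right hA ha.2.le
    nlinarith
  · have hua := h.u_pos a ⟨ha.1.le, ha.2⟩
    have hug := h.u_le ha.1.le ha.2.le
    have h1 := h.u_le_of_L_le ha hA hL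
    have hT0 : 0 ≤ -log a := by linarith [log_neg ha.1 ha.2]
    have h2 : u a ^ 2 ≤ A * u a + 2 * (-log a) + gam ^ 5 * exp (-η * gam ^ 2) * u a := calc
      u a ^ 2 = u a * u a := sq _
      _ ≤ (A + M 1 * (-log a)) * u a := by gcongr
      _ = A * u a + (M 1 * u a) * (-log a) := by ring
      _ ≤ A * u a + (2 + gam ^ 3 * exp (-η * gam ^ 2) * u a) * (-log a) := by gcongr
      _ = A * u a + 2 * (-log a) + gam ^ 3 * exp (-η * gam ^ 2) * u a * (-log a) := by ring
      _ ≤ A * u a + 2 * (-log a) + gam ^ 3 * exp (-η * gam ^ 2) * u a * gam ^ 2 := by gcongr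
      _ = _ := by ring
    have h3 : η * gam * gam ≤ (A + gam ^ 5 * exp (-η * gam ^ 2)) * gam := calc
      η * gam * gam ≤ (A + gam ^ 5 * exp (-η * gam ^ 2)) * u a := by linarith
      _ ≤ _ := by gcongr
    have h4 := le_of_mul_le_mul_right h3 h.gam_pos
    have : 0 ≤ gam ^ 5 * exp (-η * gam ^ 2) := by positivity
    linarith

/-- The Wronskian of `u` with a radial eigenfunction. -/
lemma exists_wronskian (h : RadialFlux lam beta gam u L M) {lam1 : ℝ} {v : ℝ → ℝ}
    (hv : EigenCtx lam1 v) : ∃ W : ℝ → ℝ, ContinuousOn W (Icc 0 1) ∧ W 0 = 0 ∧ W 1 = 0 ∧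
      ∀ r ∈ Ioo (0 : ℝ) 1,
        HasDerivAt W (r * v r * u r * (beta * exp (u r ^ 2) - (lam1 - lam))) r := by
  obtain ⟨-, hsm, hode, -, hv1, -⟩ := hv
  obtain ⟨p, hpc, hp⟩ := exists_radial_derivative hsm
  have huc := h.u_cont
  have hLc := h.L_cont
  have hMc := h.M_cont
  have hvc := hsm.continuousOn
  refine ⟨fun r => u r * (r * p r) + v r * (L r + M r), by fun_prop,
    by simp [h.L_zero, h.M_zero], by simp [h.u_one, hv1], fun r hr => ?_⟩
  have hr0 := hr.1.ne'
  refine (((h.u_deriv r hr).mul (hp r hr).2).add ((hp r hr).1.mul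
    ((h.L_deriv r hr).add (h.M_deriv r hr)))).congr_deriv ?_
  simp only [hode r hr, Pi.add_apply]
  field_simp
  ring

lemma beta_le (h : RadialFlux lam beta gam u L M) {lam1 : ℝ} {v : ℝ → ℝ}
    (hv : EigenCtx lam1 v) : beta ≤ lam1 - lam := by
  obtain ⟨W, hWc, hW0, hW1, hWd⟩ := h.exists_wronskian hv
  obtain ⟨r, hr, hr'⟩ := exists_hasDerivAt_eq_zero zero_lt_one hWc (hW0.trans hW1.symm) hWd
  have hvr := hv.2.2.2.1 r ⟨hr.1.le, hr.2⟩
  have hur := h.u_pos r ⟨hr.1.le, hr.2⟩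
  have hne : r * v r * u r ≠ 0 := by
    have := hr.1
    positivity
  have h1 := (mul_eq_zero.1 hr').resolve_left hne
  have h2 : 1 ≤ exp (u r ^ 2) := one_le_exp (by positivity)
  nlinarith [mul_le_mul_of_nonneg_left h2 h.beta_pos.le]

/-- Testing the equation with the eigenfunction bounds the linear mass by the exponential mass. -/
lemma L_half_le (h : RadialFlux lam beta gam u L M) {lam1 m V : ℝ} {v : ℝ → ℝ}
    (hv : EigenCtx lam1 v) (hlam : lam ≤ lam1) (hm : ∀ r ∈ Icc (0 : ℝ) (1 / 2), m ≤ v r)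
    (hV : ∀ r ∈ Icc (0 : ℝ) 1, v r ≤ V) : (lam1 - lam) * m * L (1 / 2) ≤ lam * V * M 1 := by
  obtain ⟨W, hWc, hW0, hW1, hWd⟩ := h.exists_wronskian hv
  have hl := h.lam_pos
  have hb := h.beta_pos
  have hss1 : Icc (0 : ℝ) (1 / 2) ⊆ Icc 0 1 := Icc_subset_Icc_right (by norm_num)
  have hss2 : Icc (1 / 2 : ℝ) 1 ⊆ Icc 0 1 := Icc_subset_Icc_left (by norm_num)
  have h1 := le_of_hasDerivAt_nonneg (a := 0) (b := 1 / 2)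
    (f := fun r => lam * V * M r - lam * W r - (lam1 - lam) * m * L r)
    (f' := fun r => lam * r * u r *
      ((V - v r) * (beta * exp (u r ^ 2)) + (lam1 - lam) * (v r - m))) (by norm_num)
    (by
      have := h.L_cont.mono hss1
      have := h.M_cont.mono hss1
      have := hWc.mono hss1
      fun_prop)
    (fun x hx => by
      have hx' : x ∈ Ioo (0 : ℝ) 1 := ⟨hx.1, by linarith [hx.2]⟩
      exact ((((h.M_deriv x hx').const_mul (lam * V)).sub ((hWd x hx').const_mul lam)).sub
        ((h.L_deriv x hx').const_mul ((lam1 - lam) * m))).congr_deriv (by ring))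
    (fun x hx => by
      have hx1 : x < 1 := by linarith [hx.2]
      have hx0 := hx.1
      have := h.u_pos x ⟨hx0.le, hx1⟩
      have := sub_nonneg.2 (hV x ⟨hx0.le, hx1.le⟩)
      have := sub_nonneg.2 (hm x ⟨hx0.le, hx.2.le⟩)
      have := sub_nonneg.2 hlam
      positivity)
  have h2 := le_of_hasDerivAt_nonneg (a := 1 / 2) (b := 1)
    (f := fun r => V * M r - W r)
    (f' := fun r => r * u r * ((V - v r) * (beta * exp (u r ^ 2)) + (lam1 - lam) * v r))
    (by norm_num)
    (by
      have := h.M_cont.mono hss2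
      have := hWc.mono hss2
      fun_prop)
    (fun x hx => by
      have hx' : x ∈ Ioo (0 : ℝ) 1 := ⟨by linarith [hx.1], hx.2⟩
      exact (((h.M_deriv x hx').const_mul V).sub (hWd x hx')).congr_deriv (by ring))
    (fun x hx => by
      have hx0 : 0 < x := by linarith [hx.1]
      have := h.u_pos x ⟨hx0.le, hx.2⟩
      have := sub_nonneg.2 (hV x ⟨hx0.le, hx.2.le⟩)
      have := hv.2.2.2.1 x ⟨hx0.le, hx.2⟩
      have := sub_nonneg.2 hlam
      positivity)
  simp only [h.L_zero, h.M_zero, hW0, hW1] at h1 h2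
  nlinarith [mul_le_mul_of_nonneg_left h2 hl.le]

end RadialFlux

lemma eventually_pow_five_mul_exp_le_one {η : ℝ} (hη : 0 < η) :
    ∀ᶠ γ : ℝ in atTop, γ ^ 5 * exp (-η * γ ^ 2) ≤ 1 := by
  have ht := tendsto_rpow_mul_exp_neg_mul_atTop_nhds_zero 5 η hη
  filter_upwards [ht.eventually_le_const zero_lt_one, eventually_ge_atTop 1] with γ h1 h2
  refine le_trans ?_ h1
  have h3 : γ ^ (5 : ℝ) = γ ^ 5 := by exact_mod_cast rpow_natCast γ 5
  rw [h3]
  refine mul_le_mul_of_nonneg_left (exp_le_exp.2 ?_) (by positivity)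
  nlinarith [mul_nonneg hη.le (by nlinarith : 0 ≤ γ ^ 2 - γ)]

lemma EigenCtx.exists_bounds {lam1 : ℝ} {v : ℝ → ℝ} (hv : EigenCtx lam1 v) :
    ∃ m V : ℝ, 0 < m ∧ 0 < V ∧ (∀ r ∈ Icc (0 : ℝ) (1 / 2), m ≤ v r) ∧
      ∀ r ∈ Icc (0 : ℝ) 1, v r ≤ V := by
  obtain ⟨-, hsm, -, hpos, -⟩ := hv
  have hvc := hsm.continuousOn
  obtain ⟨x, hx, hxm⟩ := isCompact_Icc.exists_isMinOn
    (nonempty_Icc.2 (by norm_num : (0 : ℝ) ≤ 1 / 2))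
    (hvc.mono (Icc_subset_Icc_right (by norm_num : (1 / 2 : ℝ) ≤ 1)))
  obtain ⟨y, hy, hyM⟩ := isCompact_Icc.exists_isMaxOn
    (nonempty_Icc.2 (zero_le_one : (0 : ℝ) ≤ 1)) hvc
  exact ⟨v x, v y, hpos x ⟨hx.1, by linarith [hx.2]⟩,
    (hpos 0 (by simp)).trans_le (hyM (by simp)), fun r hr => hxm hr, fun r hr => hyM hr⟩

/-- As γ → +∞, |log β_γ| = o(γ²), i.e. γ⁻² log β_γ → 0. -/
theorem statement8 (lam1 : ℝ) (v1 : ℝ → ℝ) (hE : EigenCtx lam1 v1) (l : ℝ) (hl : 0 < l)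
    (β : ℝ → ℝ) (u : ℝ → ℝ → ℝ) (hF : GoodFamily lam1 v1 l β u) :
    Tendsto (fun γ : ℝ => Real.log (β γ) / γ ^ 2) atTop (𝓝 0) := by
  have hlam1 := hE.1
  have hv0 : 0 < v1 0 := hE.2.2.2.1 0 (by simp)
  obtain ⟨m, V, hm, hV, hmv, hvV⟩ := hE.exists_bounds
  set c := 4 * π * v1 0 * √(lam1 / l) with hc_def
  have hc : 0 < c := by positivity
  have hbar : ∀ γ, lamBar lam1 (v1 0) l γ = lam1 - c / γ := fun γ => by
    rw [lamBar, hc_def]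
    ring
  rw [Metric.tendsto_nhds]
  intro δ hδ
  set η := min (δ / 4) 1
  have hη : 0 < η := by positivity
  have hη1 : η ≤ 1 := min_le_right _ _
  have hηδ : η ≤ δ / 4 := min_le_left _ _
  set C := 2 / √η + 2
  have hC : 0 < C := by positivity
  set K := 4 * (lam1 * V * C / (c * m))
  have hK : 0 < K := by positivity
  filter_upwards [eventually_pow_five_mul_exp_le_one hη, eventually_ge_atTop 1,
    eventually_gt_atTop (c / lam1), eventually_ge_atTop c, eventually_gt_atTop (6 / η),
    eventually_ge_atTop (16 * (K * lam1) / η ^ 2)] with γ hsmall hg1 hglam hgc hg6 hgK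
  have hg0 : 0 < γ := by linarith
  have hε : c / γ < lam1 := by
    rw [div_lt_iff₀ hlam1] at hglam
    rw [div_lt_iff₀ hg0]
    linarith
  have hε0 : 0 < c / γ := by positivity
  have hlam : 0 < lamBar lam1 (v1 0) l γ := by
    rw [hbar]
    linarith
  obtain ⟨hb0, hsol⟩ := hF γ hg0 hlam
  obtain ⟨L, M, h⟩ := hsol.exists_radialFlux hlam hb0
  rw [hbar] at h hlam
  have hb1 : β γ ≤ 1 := by
    have := h.beta_le hE
    have : c / γ ≤ 1 := (div_le_one hg0).2 hgc
    linarith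
  have hlog0 : log (β γ) ≤ 0 := log_nonpos hb0.le hb1
  have hlow : -2 * η * γ ^ 2 < log (β γ) := by
    by_contra hb
    push Not at hb
    have hM := h.M_one_mul_gam_le hη hη1 hg1 hb1 hb hsmall
    have hLhalf := h.L_half_le hE (by linarith) hmv hvV
    have hL1 : L 1 ≤ K := by
      have h1 : c * m * L (1 / 2) ≤ lam1 * V * C := calc
        c * m * L (1 / 2) = (lam1 - (lam1 - c / γ)) * m * L (1 / 2) * γ := by
          field_simp
          ring
        _ ≤ (lam1 - c / γ) * V * M 1 * γ := by gcongr
        _ = (lam1 - c / γ) * V * (M 1 * γ) := by ring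
        _ ≤ (lam1 - c / γ) * V * C := by gcongr
        _ ≤ lam1 * V * C := by
          gcongr
          linarith
      have h2 : L (1 / 2) ≤ lam1 * V * C / (c * m) := by
        rw [le_div_iff₀ (by positivity)]
        linarith
      linarith [h.L_one_le]
    have hL : ∀ r ∈ Icc (0 : ℝ) 1, L r ≤ √(K * lam1 * γ) * r := by
      intro r hr
      have hL0 := h.L_nonneg hr.1 hr.2
      rw [← pow_le_pow_iff_left₀ hL0 (mul_nonneg (sqrt_nonneg _) hr.1) two_ne_zero, mul_pow,
        sq_sqrt (by positivity)]
      calc L r ^ 2 = L r * L r := sq _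
        _ ≤ K * ((lam1 - c / γ) * γ * r ^ 2) :=
          mul_le_mul ((h.L_mono hr.1 hr.2 le_rfl).trans hL1) (h.L_le_sq hr.1 hr.2) hL0 hK.le
        _ ≤ K * (lam1 * γ * r ^ 2) := by
          gcongr
          linarith
        _ = K * lam1 * γ * r ^ 2 := by ring
    have hfin := h.mul_gam_le_of_L_le hη hη1 hg1 hb1 hb (sqrt_nonneg _) hL
    have hsq : √(K * lam1 * γ) ≤ η * γ / 4 := by
      rw [sqrt_le_left (by positivity)]
      rw [div_le_iff₀ (by positivity)] at hgK
      nlinarith [mul_le_mul_of_nonneg_right hgK hg0.le]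
    rw [div_lt_iff₀ hη] at hg6
    linarith
  rw [dist_zero_right, norm_eq_abs, abs_div, abs_of_nonpos hlog0, abs_of_pos (by positivity),
    div_lt_iff₀ (by positivity)]
  nlinarith [mul_le_mul_of_nonneg_right hηδ (sq_nonneg γ), mul_pos hδ (sq_pos_of_pos hg0)]

end
end

section
/- There exist C > 0 and γ₀ > 0 such that for all γ ≥ γ₀ and all r ∈ [0, ρ_γ], |u_γ(r) − (γ − t_γ(r)/γ)| ≤ C/γ. Moreover, ∫_{B₀(ρ_γ) \ B₀(ρ_{1,γ})} Δu_γ dy = o(γ^{−3}) as γ → +∞. -/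
open Real Set Filter MeasureTheory Topology

noncomputable section

/-- t_γ(r) = log(1 + r²/μ_γ²). -/
def tG (μγ r : ℝ) : ℝ := Real.log (1 + r ^ 2 / μγ ^ 2)

/-- Comparison of two functions through their logarithmic derivatives `r d/dr`. -/
theorem sub_le_sub_of_logDeriv_le {F G f g : ℝ → ℝ} {a b : ℝ} (hab : a ≤ b) (ha : 0 ≤ a)
    (hF : ContinuousOn F (Icc a b)) (hG : ContinuousOn G (Icc a b))
    (hF' : ∀ r ∈ Ioo a b, HasDerivAt F (f r / r) r)
    (hG' : ∀ r ∈ Ioo a b, HasDerivAt G (g r / r) r)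
    (h : ∀ r ∈ Ioo a b, f r ≤ g r) : F b - F a ≤ G b - G a := by
  have hd : ∀ r ∈ Ioo a b, HasDerivAt (fun r => G r - F r) (g r / r - f r / r) r :=
    fun r hr => (hG' r hr).sub (hF' r hr)
  have hm : MonotoneOn (fun r => G r - F r) (Icc a b) := by
    refine monotoneOn_of_deriv_nonneg (convex_Icc a b) (hG.sub hF) ?_ ?_
    · rw [interior_Icc]
      exact fun r hr => (hd r hr).differentiableAt.differentiableWithinAt
    · rw [interior_Icc]
      intro r hr
      have hr0 : 0 < r := lt_of_le_of_lt ha hr.1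
      rw [(hd r hr).deriv, ← sub_div]
      exact div_nonneg (sub_nonneg.2 (h r hr)) hr0.le
  have := hm (left_mem_Icc.2 hab) (right_mem_Icc.2 hab) hab
  simp only at this
  linarith

theorem hasDerivAt_mul_sq (c : ℝ) {r : ℝ} (hr : 0 < r) :
    HasDerivAt (fun r : ℝ => c * r ^ 2) ((2 * c * r ^ 2) / r) r := by
  refine ((hasDerivAt_pow 2 r).const_mul c).congr_deriv ?_
  have := hr.ne'
  field_simp
  push_cast
  ring

theorem hasDerivAt_mul_log (c : ℝ) {r : ℝ} (hr : 0 < r) :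
    HasDerivAt (fun r : ℝ => c * Real.log r) (c / r) r := by
  exact ((Real.hasDerivAt_log hr.ne').const_mul c).congr_deriv (div_eq_mul_inv c r).symm

theorem continuousOn_mul_log (c : ℝ) {a b : ℝ} (ha : 0 < a) :
    ContinuousOn (fun r : ℝ => c * Real.log r) (Icc a b) :=
  continuousOn_const.mul
    (Real.continuousOn_log.mono fun _ hr => (lt_of_lt_of_le ha hr.1).ne')

/-- Grönwall's inequality for the logarithmic derivative `r d/dr`. -/
theorem le_mul_exp_of_logDeriv_le {F f : ℝ → ℝ} {a b k : ℝ} (ha : 0 < a) (hab : a ≤ b)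
    (hF : ContinuousOn F (Icc a b))
    (hF' : ∀ r ∈ Ioo a b, HasDerivAt F (f r / r) r)
    (h : ∀ r ∈ Ioo a b, f r ≤ k * F r) :
    F b ≤ F a * Real.exp (k * (Real.log b - Real.log a)) := by
  have hb : 0 < b := lt_of_lt_of_le ha hab
  have key := sub_le_sub_of_logDeriv_le (F := fun r => F r * Real.exp (-k * Real.log r))
    (G := fun _ => 0)
    (f := fun r => (f r - k * F r) * Real.exp (-k * Real.log r)) (g := fun _ => 0)
    hab ha.le (hF.mul (continuousOn_mul_log (-k) ha).rexp) continuousOn_const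
    (fun r hr => by
      have hr0 : 0 < r := ha.trans hr.1
      refine ((hF' r hr).mul (hasDerivAt_mul_log (-k) hr0).exp).congr_deriv ?_
      field_simp
      ring)
    (fun r hr => by simpa using hasDerivAt_const r (0 : ℝ))
    (fun r hr => mul_nonpos_of_nonpos_of_nonneg (sub_nonpos.2 (h r hr)) (Real.exp_pos _).le)
  have h1 : F b * Real.exp (-k * Real.log b) ≤ F a * Real.exp (-k * Real.log a) := by
    linarith
  have h2 := mul_le_mul_of_nonneg_right h1 (Real.exp_pos (k * Real.log b)).le
  rw [mul_assoc, mul_assoc, ← Real.exp_add, ← Real.exp_add] at h2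
  have e1 : -k * Real.log b + k * Real.log b = 0 := by ring
  have e2 : -k * Real.log a + k * Real.log b = k * (Real.log b - Real.log a) := by ring
  rwa [e1, e2, Real.exp_zero, mul_one] at h2

/-- The flux `-r w'(r)` of a smooth radial function and the equation it satisfies. -/
theorem exists_radial_flux {w f : ℝ → ℝ} (hw : ContDiffOn ℝ (⊤ : ℕ∞) w (Icc 0 1))
    (hf : ∀ r ∈ Ioo (0 : ℝ) 1, radLap w r = f r) :
    ∃ Q : ℝ → ℝ, ContinuousOn Q (Icc 0 1) ∧ Q 0 = 0 ∧
      (∀ r ∈ Ioo (0 : ℝ) 1, HasDerivAt w (-(Q r) / r) r) ∧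
      (∀ r ∈ Ioo (0 : ℝ) 1, HasDerivAt Q (r * f r) r) := by
  have hcd : ∀ r ∈ Ioo (0 : ℝ) 1, ContDiffAt ℝ (⊤ : ℕ∞) w r := fun r hr =>
    hw.contDiffAt (Icc_mem_nhds hr.1 hr.2)
  have heq : ∀ r ∈ Ioo (0 : ℝ) 1, derivWithin w (Icc 0 1) r = deriv w r := fun r hr =>
    derivWithin_of_mem_nhds (Icc_mem_nhds hr.1 hr.2)
  refine ⟨fun r => -(r * derivWithin w (Icc 0 1) r), ?_, by simp, ?_, ?_⟩
  · exact (continuousOn_id.mul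
      (hw.continuousOn_derivWithin (uniqueDiffOn_Icc zero_lt_one) (by simp))).neg
  · intro r hr
    refine ((hcd r hr).differentiableAt (by simp)).hasDerivAt.congr_deriv ?_
    have := hr.1.ne'
    simp only [heq r hr]
    field_simp
  · intro r hr
    have h2 : HasDerivAt (deriv w) (deriv (deriv w) r) r := by
      have h3 : ContDiffAt ℝ 1 (deriv w) r := by
        have : ContDiffAt ℝ (1 + 1) w r := (hcd r hr).of_le (by
          norm_cast)
        exact (this.fderiv_right (m := 1) le_rfl).clm_apply contDiffAt_const
      exact (h3.differentiableAt (by simp)).hasDerivAt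
    have h4 := ((hasDerivAt_id r).mul h2).neg
    have h5 : (fun r => -(r * derivWithin w (Icc 0 1) r)) =ᶠ[𝓝 r] -(id * deriv w) := by
      filter_upwards [Ioo_mem_nhds hr.1 hr.2] with x hx
      simp [heq x hx]
    refine (h4.congr_of_eventuallyEq h5).congr_deriv ?_
    rw [← hf r hr, radLap]
    have := hr.1.ne'
    simp only [id]
    field_simp
    ring

/-- The rescaled nonlinear density of a bubble. -/
def bubbleMass (δ m : ℝ) (τ : ℝ → ℝ) (r : ℝ) : ℝ :=
  m * r ^ 2 * Real.exp (-(2 * τ r - δ * τ r ^ 2))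

/-- The equation for `τ = γ (γ - u)` and its flux `q = r τ'`, where `δ = γ⁻²`, `ℓ = λ γ²` and
`m = 4 / μ²`. -/
structure Bubble (δ ℓ m : ℝ) (τ q : ℝ → ℝ) : Prop where
  δ_nonneg : 0 ≤ δ
  ℓ_nonneg : 0 ≤ ℓ
  m_nonneg : 0 ≤ m
  τ_cont : ContinuousOn τ (Icc 0 1)
  q_cont : ContinuousOn q (Icc 0 1)
  τ_zero : τ 0 = 0
  q_zero : q 0 = 0
  τ_le : ∀ r ∈ Icc (0 : ℝ) 1, δ * τ r ≤ 1
  τ_deriv : ∀ r ∈ Ioo (0 : ℝ) 1, HasDerivAt τ (q r / r) r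
  q_deriv : ∀ r ∈ Ioo (0 : ℝ) 1,
    HasDerivAt q ((1 - δ * τ r) * (ℓ * r ^ 2 + bubbleMass δ m τ r) / r) r

namespace Bubble

variable {δ ℓ m : ℝ} {τ q : ℝ → ℝ}

theorem mass_nonneg (h : Bubble δ ℓ m τ q) (r : ℝ) : 0 ≤ bubbleMass δ m τ r :=
  mul_nonneg (mul_nonneg h.m_nonneg (sq_nonneg r)) (Real.exp_pos _).le

theorem q_le_q (h : Bubble δ ℓ m τ q) {a b : ℝ} (ha : 0 ≤ a) (hab : a ≤ b) (hb : b ≤ 1) :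
    q a ≤ q b := by
  have hs : Icc a b ⊆ Icc 0 1 := Icc_subset_Icc ha hb
  have hs' : Ioo a b ⊆ Ioo 0 1 := Ioo_subset_Ioo ha hb
  have := sub_le_sub_of_logDeriv_le (F := fun _ => 0) (f := fun _ => 0) hab ha
    continuousOn_const (h.q_cont.mono hs)
    (fun r hr => by simpa using hasDerivAt_const r (0 : ℝ))
    (fun r hr => h.q_deriv r (hs' hr))
    (fun r hr => mul_nonneg (sub_nonneg.2 (h.τ_le r (Ioo_subset_Icc_self (hs' hr))))
      (add_nonneg (mul_nonneg h.ℓ_nonneg (sq_nonneg r)) (h.mass_nonneg r)))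
  linarith

theorem q_nonneg (h : Bubble δ ℓ m τ q) {r : ℝ} (hr : r ∈ Icc (0 : ℝ) 1) : 0 ≤ q r := by
  have := h.q_le_q le_rfl hr.1 hr.2
  rwa [h.q_zero] at this

theorem τ_le_τ (h : Bubble δ ℓ m τ q) {a b : ℝ} (ha : 0 ≤ a) (hab : a ≤ b) (hb : b ≤ 1) :
    τ a ≤ τ b := by
  have hs : Icc a b ⊆ Icc 0 1 := Icc_subset_Icc ha hb
  have hs' : Ioo a b ⊆ Ioo 0 1 := Ioo_subset_Ioo ha hb
  have := sub_le_sub_of_logDeriv_le (F := fun _ => 0) (f := fun _ => 0) hab ha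
    continuousOn_const (h.τ_cont.mono hs)
    (fun r hr => by simpa using hasDerivAt_const r (0 : ℝ))
    (fun r hr => h.τ_deriv r (hs' hr))
    (fun r hr => h.q_nonneg (Ioo_subset_Icc_self (hs' hr)))
  linarith

theorem τ_nonneg (h : Bubble δ ℓ m τ q) {r : ℝ} (hr : r ∈ Icc (0 : ℝ) 1) : 0 ≤ τ r := by
  have := h.τ_le_τ le_rfl hr.1 hr.2
  rwa [h.τ_zero] at this

theorem mass_le_mul_exp (h : Bubble δ ℓ m τ q) {r : ℝ} (hr : r ∈ Icc (0 : ℝ) 1) :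
    bubbleMass δ m τ r ≤ m * r ^ 2 * Real.exp (-τ r) := by
  refine mul_le_mul_of_nonneg_left (Real.exp_le_exp.2 ?_)
    (mul_nonneg h.m_nonneg (sq_nonneg r))
  have := mul_le_mul_of_nonneg_right (h.τ_le r hr) (h.τ_nonneg hr)
  nlinarith

theorem mass_le (h : Bubble δ ℓ m τ q) {r : ℝ} (hr : r ∈ Icc (0 : ℝ) 1) :
    bubbleMass δ m τ r ≤ m * r ^ 2 := by
  refine (h.mass_le_mul_exp hr).trans (mul_le_of_le_one_right
    (mul_nonneg h.m_nonneg (sq_nonneg r)) (Real.exp_le_one_iff.2 ?_))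
  linarith [h.τ_nonneg hr]

theorem flux_density_le (h : Bubble δ ℓ m τ q) {r : ℝ} (hr : r ∈ Icc (0 : ℝ) 1) :
    (1 - δ * τ r) * (ℓ * r ^ 2 + bubbleMass δ m τ r) ≤ ℓ * r ^ 2 + bubbleMass δ m τ r := by
  refine mul_le_of_le_one_left
    (add_nonneg (mul_nonneg h.ℓ_nonneg (sq_nonneg r)) (h.mass_nonneg r)) ?_
  linarith [mul_nonneg h.δ_nonneg (h.τ_nonneg hr)]

theorem q_le (h : Bubble δ ℓ m τ q) {r : ℝ} (hr : r ∈ Icc (0 : ℝ) 1) :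
    q r ≤ (ℓ + m) / 2 * r ^ 2 := by
  have hs' : Ioo 0 r ⊆ Ioo 0 1 := Ioo_subset_Ioo le_rfl hr.2
  have := sub_le_sub_of_logDeriv_le (G := fun r => (ℓ + m) / 2 * r ^ 2) hr.1 le_rfl
    (h.q_cont.mono (Icc_subset_Icc le_rfl hr.2)) (by fun_prop)
    (fun x hx => h.q_deriv x (hs' hx))
    (fun x hx => hasDerivAt_mul_sq _ hx.1)
    (fun x hx => by
      have hx' := Ioo_subset_Icc_self (hs' hx)
      have := h.flux_density_le hx'
      have := h.mass_le hx'
      nlinarith)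
  simp only [h.q_zero] at this
  linarith

theorem τ_le_sq (h : Bubble δ ℓ m τ q) {r : ℝ} (hr : r ∈ Icc (0 : ℝ) 1) :
    τ r ≤ (ℓ + m) / 4 * r ^ 2 := by
  have hs' : Ioo 0 r ⊆ Ioo 0 1 := Ioo_subset_Ioo le_rfl hr.2
  have := sub_le_sub_of_logDeriv_le (G := fun r => (ℓ + m) / 4 * r ^ 2) hr.1 le_rfl
    (h.τ_cont.mono (Icc_subset_Icc le_rfl hr.2)) (by fun_prop)
    (fun x hx => h.τ_deriv x (hs' hx))
    (fun x hx => hasDerivAt_mul_sq _ hx.1)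
    (fun x hx => by
      have := h.q_le (Ioo_subset_Icc_self (hs' hx))
      linarith)
  simp only [h.τ_zero] at this
  linarith

theorem mass_cont (h : Bubble δ ℓ m τ q) : ContinuousOn (bubbleMass δ m τ) (Icc 0 1) := by
  have := h.τ_cont
  unfold bubbleMass
  fun_prop

theorem mass_deriv (h : Bubble δ ℓ m τ q) {r : ℝ} (hr : r ∈ Ioo (0 : ℝ) 1) :
    HasDerivAt (bubbleMass δ m τ)
      (2 * bubbleMass δ m τ r * (1 - (1 - δ * τ r) * q r) / r) r := by
  have h1 := h.τ_deriv r hr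
  have h2 := ((hasDerivAt_pow 2 r).const_mul m).mul
    (((h1.const_mul 2).sub ((h1.pow 2).const_mul δ)).neg.exp)
  refine h2.congr_deriv ?_
  have := hr.1.ne'
  simp only [bubbleMass, Pi.sub_apply, Pi.neg_apply, Pi.pow_apply]
  field_simp
  push_cast
  ring

theorem energy_cont (h : Bubble δ ℓ m τ q) :
    ContinuousOn (fun r => (1 - q r) ^ 2 + bubbleMass δ m τ r) (Icc 0 1) :=
  ((continuousOn_const.sub h.q_cont).pow 2).add h.mass_cont

/-- The Pohozaev-type identity. -/
theorem energy_deriv (h : Bubble δ ℓ m τ q) {r : ℝ} (hr : r ∈ Ioo (0 : ℝ) 1) :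
    HasDerivAt (fun r => (1 - q r) ^ 2 + bubbleMass δ m τ r)
      ((2 * (δ * τ r) * bubbleMass δ m τ r
        - 2 * (1 - q r) * (1 - δ * τ r) * (ℓ * r ^ 2)) / r) r := by
  have h2 := (((h.q_deriv r hr).const_sub 1).pow 2).add (h.mass_deriv hr)
  refine h2.congr_deriv ?_
  have := hr.1.ne'
  field_simp
  push_cast
  ring

theorem energy_zero (h : Bubble δ ℓ m τ q) : (1 - q 0) ^ 2 + bubbleMass δ m τ 0 = 1 := by
  simp [h.q_zero, bubbleMass]

theorem le_energy (h : Bubble δ ℓ m τ q) {r : ℝ} (hr : r ∈ Icc (0 : ℝ) 1) :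
    1 - ℓ * r ^ 2 ≤ (1 - q r) ^ 2 + bubbleMass δ m τ r := by
  have hs' : Ioo 0 r ⊆ Ioo 0 1 := Ioo_subset_Ioo le_rfl hr.2
  have := sub_le_sub_of_logDeriv_le (F := fun r => -ℓ * r ^ 2) hr.1 le_rfl
    (by fun_prop) (h.energy_cont.mono (Icc_subset_Icc le_rfl hr.2))
    (fun x hx => hasDerivAt_mul_sq _ hx.1)
    (fun x hx => h.energy_deriv (hs' hx))
    (fun x hx => by
      have hx' := Ioo_subset_Icc_self (hs' hx)
      have h1 := mul_nonneg h.δ_nonneg (h.τ_nonneg hx')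
      have h2 := h.τ_le x hx'
      have h3 := mul_nonneg h1 (h.mass_nonneg x)
      have h4 := h.q_nonneg hx'
      have h5 := mul_nonneg h.ℓ_nonneg (sq_nonneg x)
      have h6 : (1 - q x) * (1 - δ * τ x) ≤ 1 := by nlinarith
      nlinarith [mul_le_mul_of_nonneg_right h6 h5])
  rw [h.energy_zero] at this
  linarith

theorem mass_growth_of_q_le_one (h : Bubble δ ℓ m τ q) {a b k : ℝ} (ha : 0 < a) (hab : a ≤ b)
    (hb : b ≤ 1) (hk : 2 * (δ * τ b) ≤ k) (hq : q b ≤ 1) :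
    bubbleMass δ m τ b ≤
      (m * a ^ 2 + 1) * Real.exp (k * (Real.log b - Real.log a)) := by
  have hs : Icc a b ⊆ Icc 0 1 := Icc_subset_Icc ha.le hb
  have hs' : Ioo a b ⊆ Ioo 0 1 := Ioo_subset_Ioo ha.le hb
  have key := le_mul_exp_of_logDeriv_le (k := k) ha hab (h.energy_cont.mono hs)
    (fun x hx => h.energy_deriv (hs' hx))
    (fun x hx => by
      have hx' := Ioo_subset_Icc_self (hs' hx)
      have h1 : δ * τ x ≤ δ * τ b :=
        mul_le_mul_of_nonneg_left (h.τ_le_τ hx'.1 hx.2.le hb) h.δ_nonneg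
      have h2 : q x ≤ 1 := (h.q_le_q hx'.1 hx.2.le hb).trans hq
      have h3 := mul_nonneg (mul_nonneg (sub_nonneg.2 h2) (sub_nonneg.2 (h.τ_le x hx')))
        (mul_nonneg h.ℓ_nonneg (sq_nonneg x))
      have h4 := mul_nonneg h.δ_nonneg (h.τ_nonneg hx')
      have h5 := mul_le_mul_of_nonneg_right (by linarith : 2 * (δ * τ x) ≤ k) (h.mass_nonneg x)
      have h6 := mul_nonneg (by linarith : 0 ≤ k) (sq_nonneg (1 - q x))
      nlinarith)
  have h1 : (1 - q a) ^ 2 ≤ 1 := by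
    have h2 := h.q_le_q ha.le hab hb
    have h3 := h.q_nonneg ⟨ha.le, hab.trans hb⟩
    nlinarith
  have h2 := h.mass_le ⟨ha.le, hab.trans hb⟩
  calc bubbleMass δ m τ b ≤ (1 - q b) ^ 2 + bubbleMass δ m τ b := by nlinarith [sq_nonneg (1 - q b)]
    _ ≤ _ := key
    _ ≤ _ := mul_le_mul_of_nonneg_right (by linarith) (Real.exp_pos _).le

theorem mass_growth_of_one_le_q (h : Bubble δ ℓ m τ q) {a b k : ℝ} (ha : 0 < a) (hab : a ≤ b)
    (hb : b ≤ 1) (hk : 2 * (δ * τ b) ≤ k) (hq : 1 ≤ q a) :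
    bubbleMass δ m τ b ≤
      bubbleMass δ m τ a * Real.exp (k * (Real.log b - Real.log a)) := by
  have hs : Icc a b ⊆ Icc 0 1 := Icc_subset_Icc ha.le hb
  have hs' : Ioo a b ⊆ Ioo 0 1 := Ioo_subset_Ioo ha.le hb
  refine le_mul_exp_of_logDeriv_le (k := k) ha hab (h.mass_cont.mono hs)
    (fun x hx => h.mass_deriv (hs' hx))
    (fun x hx => ?_)
  have hx' := Ioo_subset_Icc_self (hs' hx)
  have h1 : δ * τ x ≤ δ * τ b :=
    mul_le_mul_of_nonneg_left (h.τ_le_τ hx'.1 hx.2.le hb) h.δ_nonneg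
  have h2 : 1 ≤ q x := hq.trans (h.q_le_q ha.le hx.1.le hx'.2)
  have h3 := mul_le_mul_of_nonneg_left h2 (sub_nonneg.2 (h.τ_le x hx'))
  have h4 := h.mass_nonneg x
  nlinarith

theorem mass_growth (h : Bubble δ ℓ m τ q) {a b k : ℝ} (ha : 0 < a) (hab : a ≤ b)
    (hb : b ≤ 1) (hk : 2 * (δ * τ b) ≤ k) :
    bubbleMass δ m τ b ≤
      (m * a ^ 2 + 1) * Real.exp (k * (Real.log b - Real.log a)) := by
  rcases le_total (q b) 1 with hqb | hqb
  · exact h.mass_growth_of_q_le_one ha hab hb hk hqb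
  rcases le_total 1 (q a) with hqa | hqa
  · refine (h.mass_growth_of_one_le_q ha hab hb hk hqa).trans
      (mul_le_mul_of_nonneg_right ?_ (Real.exp_pos _).le)
    linarith [h.mass_le ⟨ha.le, hab.trans hb⟩]
  obtain ⟨c, hc, hqc⟩ := intermediate_value_Icc hab
    (h.q_cont.mono (Icc_subset_Icc ha.le hb)) ⟨hqa, hqb⟩
  have hc0 : 0 < c := ha.trans_le hc.1
  have hkc : 2 * (δ * τ c) ≤ k := by
    have := mul_le_mul_of_nonneg_left (h.τ_le_τ hc0.le hc.2 hb) h.δ_nonneg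
    linarith
  have h1 := h.mass_growth_of_q_le_one ha hc.1 (hc.2.trans hb) hkc hqc.le
  have h2 := h.mass_growth_of_one_le_q hc0 hc.2 hb hk hqc.ge
  calc _ ≤ _ := h2
    _ ≤ _ := mul_le_mul_of_nonneg_right h1 (Real.exp_pos _).le
    _ = _ := by rw [mul_assoc, ← Real.exp_add]; ring_nf

end Bubble

namespace Bubble

variable {δ ℓ m : ℝ} {τ q : ℝ → ℝ}

theorem two_mul_sub_mono {δ x y : ℝ} (hδ : 0 ≤ δ) (hy : δ * y ≤ 1) (hxy : x ≤ y) :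
    2 * x - δ * x ^ 2 ≤ 2 * y - δ * y ^ 2 := by
  have h1 : δ * x ≤ δ * y := mul_le_mul_of_nonneg_left hxy hδ
  nlinarith [mul_nonneg (sub_nonneg.2 hxy) (by linarith : 0 ≤ 2 - δ * x - δ * y)]

variable {μ κ : ℝ}

theorem mass_bound_of_scale (hμ : 0 < μ) : 4 / μ ^ 2 * μ ^ 2 = 4 := by
  field_simp

/-- At the bubble scale the flux is bounded below. -/
theorem inv_le_q_scale (h : Bubble δ ℓ (4 / μ ^ 2) τ q) (hμ : 0 < μ) (hμ1 : μ ≤ 1)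
    (hℓ : ℓ * μ ^ 2 ≤ 1) (hδ : δ * 2 ≤ 1 / 2) : 1 / 27 ≤ q μ := by
  have hm := mass_bound_of_scale hμ
  have hs' : Ioo 0 μ ⊆ Ioo 0 1 := Ioo_subset_Ioo le_rfl hμ1
  have hτμ : τ μ ≤ 3 / 2 := by
    have := h.τ_le_sq ⟨hμ.le, hμ1⟩
    nlinarith
  have he : 1 / 27 ≤ Real.exp (-3) := by
    have h1 : Real.exp (-3) * Real.exp 3 = 1 := by rw [← Real.exp_add]; norm_num
    have h2 : Real.exp 3 ≤ 27 := by
      have h3 : Real.exp 3 = Real.exp 1 ^ 3 := by rw [← Real.exp_nat_mul]; norm_num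
      have h4 : Real.exp 1 ≤ 3 := by linarith [Real.exp_one_lt_d9]
      have := pow_le_pow_left₀ (Real.exp_pos 1).le h4 3
      rw [h3]; linarith
    nlinarith [Real.exp_pos (-3)]
  have := sub_le_sub_of_logDeriv_le (F := fun r => 4 / μ ^ 2 / 108 * r ^ 2) hμ.le le_rfl
    (by fun_prop) (h.q_cont.mono (Icc_subset_Icc le_rfl hμ1))
    (fun x hx => hasDerivAt_mul_sq _ hx.1)
    (fun x hx => h.q_deriv x (hs' hx))
    (fun x hx => by
      have hx' := Ioo_subset_Icc_self (hs' hx)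
      have h1 : τ x ≤ 3 / 2 := (h.τ_le_τ hx'.1 hx.2.le hμ1).trans hτμ
      have h2 := mul_le_mul_of_nonneg_left h1 h.δ_nonneg
      have h3 : 1 / 27 ≤ Real.exp (-(2 * τ x - δ * τ x ^ 2)) := by
        refine he.trans (Real.exp_le_exp.2 ?_)
        nlinarith [mul_nonneg h.δ_nonneg (sq_nonneg (τ x))]
      have h4 := mul_nonneg h.m_nonneg (sq_nonneg x)
      have h5 : 4 / μ ^ 2 * x ^ 2 * (1 / 27) ≤ bubbleMass δ (4 / μ ^ 2) τ x :=
        mul_le_mul_of_nonneg_left h3 h4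
      have h6 := mul_nonneg h.ℓ_nonneg (sq_nonneg x)
      have h7 : 1 / 2 ≤ 1 - δ * τ x := by linarith
      have h8 := mul_le_mul h7 (by linarith : 4 / μ ^ 2 * x ^ 2 * (1 / 27)
        ≤ ℓ * x ^ 2 + bubbleMass δ (4 / μ ^ 2) τ x) (by linarith) (by linarith)
      linarith)
  simp only [h.q_zero] at this
  linarith

/-- After a bounded number of scales the flux exceeds `3 / 2`. -/
theorem three_halves_le_q (h : Bubble δ ℓ (4 / μ ^ 2) τ q) (hμ : 0 < μ) (hκ : 1 ≤ κ)
    (hlog : Real.log κ = 60) (hκμ : κ * μ ≤ 1) (hℓ : ℓ * (κ * μ) ^ 2 ≤ 1 / 50)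
    (hδ : δ * (κ ^ 2 + 1) ≤ 1 / 2) : 3 / 2 ≤ q (κ * μ) := by
  have hm := mass_bound_of_scale hμ
  have hle : μ ≤ κ * μ := le_mul_of_one_le_left hμ.le hκ
  have hκμ0 : 0 < κ * μ := hμ.trans_le hle
  have hℓμ : ℓ * μ ^ 2 ≤ 1 / 50 :=
    (mul_le_mul_of_nonneg_left (pow_le_pow_left₀ hμ.le hle 2) h.ℓ_nonneg).trans hℓ
  have hq0 := h.inv_le_q_scale hμ (hle.trans hκμ) (by linarith)
    (by nlinarith [h.δ_nonneg, mul_nonneg h.δ_nonneg (by nlinarith : 0 ≤ κ ^ 2 - 1)])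
  by_contra! hlt
  have hτκ : τ (κ * μ) ≤ κ ^ 2 + 1 := by
    have := h.τ_le_sq ⟨hκμ0.le, hκμ⟩
    have : 4 / μ ^ 2 * (κ * μ) ^ 2 = 4 * κ ^ 2 := by rw [mul_pow]; linear_combination κ ^ 2 * hm
    nlinarith
  have hs : Icc μ (κ * μ) ⊆ Icc 0 1 := Icc_subset_Icc hμ.le hκμ
  have hs' : Ioo μ (κ * μ) ⊆ Ioo 0 1 := Ioo_subset_Ioo hμ.le hκμ
  have := sub_le_sub_of_logDeriv_le (F := fun r => 1 / 40 * Real.log r) hle hμ.le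
    (continuousOn_mul_log _ hμ) (h.q_cont.mono hs)
    (fun x hx => hasDerivAt_mul_log _ (hμ.trans hx.1))
    (fun x hx => h.q_deriv x (hs' hx))
    (fun x hx => by
      have hx' := Ioo_subset_Icc_self (hs' hx)
      have h1 := h.le_energy hx'
      have h2 : q x ≤ 3 / 2 := (h.q_le_q hx'.1 hx.2.le hκμ).trans hlt.le
      have h3 : 1 / 27 ≤ q x := hq0.trans (h.q_le_q hμ.le hx.1.le hx'.2)
      have h4 : ℓ * x ^ 2 ≤ 1 / 50 :=
        (mul_le_mul_of_nonneg_left (pow_le_pow_left₀ hx'.1 hx.2.le 2) h.ℓ_nonneg).trans hℓ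
      have h5 : 1 / 20 ≤ bubbleMass δ (4 / μ ^ 2) τ x := by nlinarith
      have h6 := mul_le_mul_of_nonneg_left ((h.τ_le_τ hx'.1 hx.2.le hκμ).trans hτκ) h.δ_nonneg
      have h7 := mul_nonneg h.ℓ_nonneg (sq_nonneg x)
      have h8 := mul_le_mul (by linarith : 1 / 2 ≤ 1 - δ * τ x) (by linarith : 1 / 20
        ≤ ℓ * x ^ 2 + bubbleMass δ (4 / μ ^ 2) τ x) (by norm_num) (by linarith)
      linarith)
  simp only [Real.log_mul (by linarith : κ ≠ 0) hμ.ne', hlog] at this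
  linarith

/-- Decay of the nonlinear density away from the bubble. -/
theorem mass_decay (h : Bubble δ ℓ (4 / μ ^ 2) τ q) (hμ : 0 < μ) (hκ : 1 ≤ κ)
    (hq : 3 / 2 ≤ q (κ * μ)) {r : ℝ} (hr : κ * μ ≤ r) (hr1 : r ≤ 1)
    (hz : δ * (Real.log r - Real.log (κ * μ)) ^ 2 ≤ 1) :
    bubbleMass δ (4 / μ ^ 2) τ r ≤ 4 * Real.exp 3 * κ ^ 3 * (μ / r) := by
  have hκμ0 : 0 < κ * μ := mul_pos (by linarith) hμ
  have hr0 : 0 < r := hκμ0.trans_le hr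
  set z := Real.log r - Real.log (κ * μ) with hzdef
  have hτ : 3 / 2 * z ≤ τ r := by
    have := sub_le_sub_of_logDeriv_le (F := fun r => 3 / 2 * Real.log r) hr hκμ0.le
      (continuousOn_mul_log _ hκμ0) (h.τ_cont.mono (Icc_subset_Icc hκμ0.le hr1))
      (fun x hx => hasDerivAt_mul_log _ (hκμ0.trans hx.1))
      (fun x hx => h.τ_deriv x (Ioo_subset_Ioo hκμ0.le hr1 hx))
      (fun x hx => hq.trans (h.q_le_q hκμ0.le hx.1.le (hx.2.le.trans hr1)))
    have := h.τ_nonneg ⟨hκμ0.le, hr.trans hr1⟩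
    linarith
  have h1 := two_mul_sub_mono h.δ_nonneg (h.τ_le r ⟨hr0.le, hr1⟩) hτ
  have h2 : Real.exp (-(2 * τ r - δ * τ r ^ 2)) ≤ Real.exp 3 * (κ * μ / r) ^ 3 := by
    have : κ * μ / r = Real.exp (-z) := by
      rw [hzdef, neg_sub, Real.exp_sub, Real.exp_log hκμ0, Real.exp_log hr0]
    rw [this, ← Real.exp_nat_mul, ← Real.exp_add]
    refine Real.exp_le_exp.2 ?_
    push_cast
    linarith
  calc bubbleMass δ (4 / μ ^ 2) τ r
      ≤ 4 / μ ^ 2 * r ^ 2 * (Real.exp 3 * (κ * μ / r) ^ 3) :=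
        mul_le_mul_of_nonneg_left h2 (mul_nonneg h.m_nonneg (sq_nonneg r))
    _ = _ := by field_simp

end Bubble

theorem hasDerivAt_mul_div (c μ : ℝ) {r : ℝ} (hr : 0 < r) :
    HasDerivAt (fun r : ℝ => c * (μ / r)) ((-c * (μ / r)) / r) r := by
  refine (((hasDerivAt_const r μ).div (hasDerivAt_id r) hr.ne').const_mul c).congr_deriv ?_
  have := hr.ne'
  simp only [id]
  field_simp
  ring

theorem continuousOn_mul_div (c μ : ℝ) {a b : ℝ} (ha : 0 < a) :
    ContinuousOn (fun r : ℝ => c * (μ / r)) (Icc a b) :=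
  continuousOn_const.mul (continuousOn_const.div continuousOn_id
    fun _ hr => (lt_of_lt_of_le ha hr.1).ne')

namespace Bubble

variable {δ ℓ m μ κ : ℝ} {τ q : ℝ → ℝ}

/-- Constant in the decay of the nonlinear density. -/
def decayConst (κ : ℝ) : ℝ := 4 * Real.exp 3 * κ ^ 3

/-- A priori bound of the flux. -/
def fluxConst (κ : ℝ) : ℝ := 2 * κ ^ 2 + 1 + decayConst κ

/-- Constant in the sharp bound of the flux. -/
def sharpConst (κ : ℝ) : ℝ := fluxConst κ * (4 * κ ^ 2 + 2 + 4 * decayConst κ)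

theorem decayConst_nonneg (hκ : 1 ≤ κ) : 0 ≤ decayConst κ := by
  unfold decayConst; positivity

theorem fluxConst_nonneg (hκ : 1 ≤ κ) : 0 ≤ fluxConst κ := by
  have := decayConst_nonneg hκ
  unfold fluxConst; positivity

theorem sharpConst_nonneg (hκ : 1 ≤ κ) : 0 ≤ sharpConst κ := by
  have := decayConst_nonneg hκ
  have := fluxConst_nonneg hκ
  unfold sharpConst; positivity

/-- The situation outside the bubble core, up to the radius `R`. -/
structure Outer (δ ℓ μ κ : ℝ) (τ q : ℝ → ℝ) (R : ℝ) : Prop where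
  bubble : Bubble δ ℓ (4 / μ ^ 2) τ q
  μ_pos : 0 < μ
  one_le_κ : 1 ≤ κ
  le_R : κ * μ ≤ R
  R_le : R ≤ 1
  le_q : 3 / 2 ≤ q (κ * μ)
  δ_le : δ ≤ 1
  log_le : δ * (Real.log R - Real.log (κ * μ)) ^ 2 ≤ 1
  small : ℓ * R ^ 2 ≤ δ

variable {R : ℝ}

theorem Outer.κμ_pos (o : Outer δ ℓ μ κ τ q R) : 0 < κ * μ :=
  mul_pos (by linarith [o.one_le_κ]) o.μ_pos

theorem Outer.mono (o : Outer δ ℓ μ κ τ q R) {r : ℝ} (hr : κ * μ ≤ r) (hrR : r ≤ R) :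
    Outer δ ℓ μ κ τ q r where
  bubble := o.bubble
  μ_pos := o.μ_pos
  one_le_κ := o.one_le_κ
  le_R := hr
  R_le := hrR.trans o.R_le
  le_q := o.le_q
  δ_le := o.δ_le
  log_le := by
    have hr0 := o.κμ_pos.trans_le hr
    have h1 := Real.log_le_log hr0 hrR
    have h2 := Real.log_le_log o.κμ_pos hr
    refine le_trans (mul_le_mul_of_nonneg_left ?_ o.bubble.δ_nonneg) o.log_le
    exact pow_le_pow_left₀ (by linarith) (by linarith) 2
  small := (mul_le_mul_of_nonneg_left (pow_le_pow_left₀ (o.κμ_pos.le.trans hr) hrR 2)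
    o.bubble.ℓ_nonneg).trans o.small

theorem Outer.mass_le (o : Outer δ ℓ μ κ τ q R) :
    bubbleMass δ (4 / μ ^ 2) τ R ≤ decayConst κ * (μ / R) :=
  o.bubble.mass_decay o.μ_pos o.one_le_κ o.le_q o.le_R o.R_le o.log_le

theorem Outer.core_mem (o : Outer δ ℓ μ κ τ q R) : κ * μ ∈ Icc (0 : ℝ) 1 :=
  ⟨o.κμ_pos.le, o.le_R.trans o.R_le⟩

theorem Outer.core_mass_sq (o : Outer δ ℓ μ κ τ q R) :
    4 / μ ^ 2 * (κ * μ) ^ 2 = 4 * κ ^ 2 := by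
  have := o.μ_pos.ne'
  field_simp

theorem Outer.core_small (o : Outer δ ℓ μ κ τ q R) : ℓ * (κ * μ) ^ 2 ≤ δ :=
  (o.mono le_rfl o.le_R).small

theorem Outer.core_div (o : Outer δ ℓ μ κ τ q R) : μ / (κ * μ) ≤ 1 := by
  rw [div_le_one o.κμ_pos]
  exact le_mul_of_one_le_left o.μ_pos.le o.one_le_κ

theorem Outer.τ_core_le (o : Outer δ ℓ μ κ τ q R) : τ (κ * μ) ≤ fluxConst κ := by
  have := o.bubble.τ_le_sq o.core_mem
  have := o.core_mass_sq
  have := o.core_small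
  have := o.δ_le
  have := decayConst_nonneg o.one_le_κ
  unfold fluxConst
  nlinarith

theorem Outer.q_le (o : Outer δ ℓ μ κ τ q R) : q R ≤ fluxConst κ := by
  have h := o.bubble
  have hC := decayConst_nonneg o.one_le_κ
  have := sub_le_sub_of_logDeriv_le
    (G := fun r => -decayConst κ * (μ / r) + ℓ / 2 * r ^ 2) o.le_R o.κμ_pos.le
    (h.q_cont.mono (Icc_subset_Icc o.κμ_pos.le o.R_le))
    ((continuousOn_mul_div _ _ o.κμ_pos).add (by fun_prop))
    (fun x hx => h.q_deriv x (Ioo_subset_Ioo o.κμ_pos.le o.R_le hx))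
    (fun x hx => by
      have hx0 := o.κμ_pos.trans hx.1
      exact ((hasDerivAt_mul_div _ _ hx0).add (hasDerivAt_mul_sq _ hx0)).congr_deriv
        (add_div _ _ _).symm)
    (fun x hx => by
      have hx0 := o.κμ_pos.trans hx.1
      have h1 := (o.mono hx.1.le hx.2.le).mass_le
      have h2 := h.flux_density_le ⟨hx0.le, hx.2.le.trans o.R_le⟩
      linarith)
  have h1 := h.q_le o.core_mem
  have h2 := o.core_mass_sq
  have h3 := o.core_small
  have h4 := mul_le_mul_of_nonneg_left o.core_div hC
  have h5 := mul_nonneg hC (div_nonneg o.μ_pos.le (o.κμ_pos.le.trans o.le_R))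
  have h6 := o.small
  have h7 := o.δ_le
  unfold fluxConst
  nlinarith [mul_nonneg h.ℓ_nonneg (sq_nonneg (κ * μ))]

theorem Outer.τ_le (o : Outer δ ℓ μ κ τ q R) :
    τ R ≤ fluxConst κ * (1 + (Real.log R - Real.log (κ * μ))) := by
  have h := o.bubble
  have := sub_le_sub_of_logDeriv_le
    (G := fun r => fluxConst κ * Real.log r) o.le_R o.κμ_pos.le
    (h.τ_cont.mono (Icc_subset_Icc o.κμ_pos.le o.R_le))
    (continuousOn_mul_log _ o.κμ_pos)
    (fun x hx => h.τ_deriv x (Ioo_subset_Ioo o.κμ_pos.le o.R_le hx))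
    (fun x hx => hasDerivAt_mul_log _ (o.κμ_pos.trans hx.1))
    (fun x hx => (o.mono hx.1.le hx.2.le).q_le)
  have := o.τ_core_le
  linarith

theorem Outer.core_energy_le (o : Outer δ ℓ μ κ τ q R) :
    (1 - q (κ * μ)) ^ 2 + bubbleMass δ (4 / μ ^ 2) τ (κ * μ)
      ≤ 1 + fluxConst κ * (4 * κ ^ 2 + 1) * δ := by
  have h := o.bubble
  have hs : Icc 0 (κ * μ) ⊆ Icc 0 1 := Icc_subset_Icc le_rfl o.core_mem.2
  have hs' : Ioo 0 (κ * μ) ⊆ Ioo 0 1 := Ioo_subset_Ioo le_rfl o.core_mem.2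
  have hC := fluxConst_nonneg o.one_le_κ
  have hq : q (κ * μ) ≤ fluxConst κ := (o.mono le_rfl o.le_R).q_le
  have := sub_le_sub_of_logDeriv_le
    (G := fun r => fluxConst κ * (δ * (4 / μ ^ 2) + ℓ) * r ^ 2) o.κμ_pos.le le_rfl
    (h.energy_cont.mono hs) (by fun_prop)
    (fun x hx => h.energy_deriv (hs' hx))
    (fun x hx => hasDerivAt_mul_sq _ hx.1)
    (fun x hx => by
      have hx' := Ioo_subset_Icc_self (hs' hx)
      have h1 := (h.τ_le_τ hx'.1 hx.2.le o.core_mem.2).trans o.τ_core_le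
      have h2 := (h.q_le_q hx'.1 hx.2.le o.core_mem.2).trans hq
      have h3 := h.q_nonneg hx'
      have h4 := h.τ_le x hx'
      have h5 := mul_nonneg h.δ_nonneg (h.τ_nonneg hx')
      have h6 : (q x - 1) * (1 - δ * τ x) ≤ fluxConst κ := by nlinarith
      have h7 := mul_le_mul_of_nonneg_right h6 (mul_nonneg h.ℓ_nonneg (sq_nonneg x))
      have h8 : τ x * bubbleMass δ (4 / μ ^ 2) τ x ≤ fluxConst κ * (4 / μ ^ 2 * x ^ 2) :=
        mul_le_mul h1 (h.mass_le hx') (h.mass_nonneg x) hC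
      have h9 := mul_le_mul_of_nonneg_left h8 h.δ_nonneg
      linarith)
  have h1 := o.core_mass_sq
  have h3 := mul_le_mul_of_nonneg_left o.core_small hC
  simp only [h.energy_zero] at this
  linear_combination this + h3 + fluxConst κ * δ * h1

theorem Outer.energy_le (o : Outer δ ℓ μ κ τ q R) :
    (1 - q R) ^ 2 + bubbleMass δ (4 / μ ^ 2) τ R ≤ 1 + sharpConst κ * δ := by
  have h := o.bubble
  have hC := fluxConst_nonneg o.one_le_κ
  have hD := decayConst_nonneg o.one_le_κ
  have hR0 := o.κμ_pos.trans_le o.le_R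
  set c := 2 * δ * fluxConst κ * decayConst κ with hc
  have hc0 : 0 ≤ c := by have := h.δ_nonneg; positivity
  have := sub_le_sub_of_logDeriv_le
    (G := fun r => -c * (μ / r) * (2 - Real.log (κ * μ) + 1 * Real.log r)
      + fluxConst κ * ℓ * r ^ 2)
    (g := fun r => c * (μ / r) * (1 + (Real.log r - Real.log (κ * μ)))
      + 2 * (fluxConst κ * ℓ) * r ^ 2) o.le_R o.κμ_pos.le
    (h.energy_cont.mono (Icc_subset_Icc o.κμ_pos.le o.R_le))
    (((continuousOn_mul_div _ _ o.κμ_pos).mul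
      (continuousOn_const.add (continuousOn_mul_log _ o.κμ_pos))).add (by fun_prop))
    (fun x hx => h.energy_deriv (Ioo_subset_Ioo o.κμ_pos.le o.R_le hx))
    (fun x hx => by
      have hx0 := o.κμ_pos.trans hx.1
      refine (((hasDerivAt_mul_div _ _ hx0).mul
        ((hasDerivAt_mul_log 1 hx0).const_add _)).add (hasDerivAt_mul_sq _ hx0)).congr_deriv ?_
      field_simp
      ring)
    (fun x hx => by
      have hx0 := o.κμ_pos.trans hx.1
      have hx' : x ∈ Icc (0 : ℝ) 1 := ⟨hx0.le, hx.2.le.trans o.R_le⟩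
      have ox := o.mono hx.1.le hx.2.le
      have h1 := ox.τ_le
      have h2 := ox.q_le
      have h3 := h.q_nonneg hx'
      have h4 := h.τ_le x hx'
      have h5 := mul_nonneg h.δ_nonneg (h.τ_nonneg hx')
      have h6 : (q x - 1) * (1 - δ * τ x) ≤ fluxConst κ := by nlinarith
      have h7 := mul_le_mul_of_nonneg_right h6 (mul_nonneg h.ℓ_nonneg (sq_nonneg x))
      have h8 := mul_le_mul h1 ox.mass_le (h.mass_nonneg x)
        ((h.τ_nonneg hx').trans h1)
      have h9 := mul_le_mul_of_nonneg_left h8 h.δ_nonneg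
      rw [hc]
      linarith)
  have h1 := o.core_energy_le
  have h2 : c * (μ / (κ * μ)) ≤ c := mul_le_of_le_one_right hc0 o.core_div
  have h3 := Real.log_le_log o.κμ_pos o.le_R
  have h4 : 0 ≤ c * (μ / R) * (2 - Real.log (κ * μ) + 1 * Real.log R) :=
    mul_nonneg (mul_nonneg hc0 (div_nonneg o.μ_pos.le hR0.le)) (by linarith)
  have h5 := mul_le_mul_of_nonneg_left o.small hC
  have h6 := mul_nonneg (mul_nonneg hC h.ℓ_nonneg) (sq_nonneg (κ * μ))
  unfold sharpConst
  linarith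

theorem Outer.q_le_two_add (o : Outer δ ℓ μ κ τ q R) : q R ≤ 2 + sharpConst κ * δ := by
  have h1 := o.energy_le
  have h2 := o.bubble.mass_nonneg R
  have h3 := mul_nonneg (sharpConst_nonneg o.one_le_κ) o.bubble.δ_nonneg
  nlinarith

theorem Outer.le_q_self (o : Outer δ ℓ μ κ τ q R) :
    2 - ℓ * R ^ 2 - bubbleMass δ (4 / μ ^ 2) τ R ≤ q R := by
  have hR : R ∈ Icc (0 : ℝ) 1 := ⟨o.κμ_pos.le.trans o.le_R, o.R_le⟩
  have h1 := o.bubble.le_energy hR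
  have h2 := o.bubble.mass_nonneg R
  have h3 := mul_nonneg o.bubble.ℓ_nonneg (sq_nonneg R)
  have h4 := o.le_q.trans (o.bubble.q_le_q o.κμ_pos.le o.le_R o.R_le)
  nlinarith

theorem Outer.τ_sub_le (o : Outer δ ℓ μ κ τ q R) :
    τ R ≤ 2 * (Real.log R - Real.log (κ * μ)) + (fluxConst κ + sharpConst κ) := by
  have h := o.bubble
  have := sub_le_sub_of_logDeriv_le
    (G := fun r => (2 + sharpConst κ * δ) * Real.log r) o.le_R o.κμ_pos.le
    (h.τ_cont.mono (Icc_subset_Icc o.κμ_pos.le o.R_le))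
    (continuousOn_mul_log _ o.κμ_pos)
    (fun x hx => h.τ_deriv x (Ioo_subset_Ioo o.κμ_pos.le o.R_le hx))
    (fun x hx => hasDerivAt_mul_log _ (o.κμ_pos.trans hx.1))
    (fun x hx => (o.mono hx.1.le hx.2.le).q_le_two_add)
  have h1 := o.τ_core_le
  have h2 := Real.log_le_log o.κμ_pos o.le_R
  have h3 : δ * (Real.log R - Real.log (κ * μ)) ≤ 1 := by
    have := o.log_le
    have := o.δ_le
    have := h.δ_nonneg
    rcases le_total (Real.log R - Real.log (κ * μ)) 1 with hz | hz
    · nlinarith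
    · nlinarith
  have h4 := mul_le_mul_of_nonneg_left h3 (sharpConst_nonneg o.one_le_κ)
  linarith

theorem Outer.le_τ (o : Outer δ ℓ μ κ τ q R) :
    2 * (Real.log R - Real.log (κ * μ)) - fluxConst κ ≤ τ R := by
  have h := o.bubble
  have hC := decayConst_nonneg o.one_le_κ
  have := sub_le_sub_of_logDeriv_le
    (F := fun r => 2 * Real.log r + (decayConst κ * (μ / r) + (-(ℓ / 2)) * r ^ 2))
    o.le_R o.κμ_pos.le
    ((continuousOn_mul_log _ o.κμ_pos).add
      ((continuousOn_mul_div _ _ o.κμ_pos).add (by fun_prop)))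
    (h.τ_cont.mono (Icc_subset_Icc o.κμ_pos.le o.R_le))
    (fun x hx => by
      have hx0 := o.κμ_pos.trans hx.1
      refine ((hasDerivAt_mul_log _ hx0).add
        ((hasDerivAt_mul_div _ _ hx0).add (hasDerivAt_mul_sq _ hx0))).congr_deriv ?_
      rw [← add_div, ← add_div])
    (fun x hx => h.τ_deriv x (Ioo_subset_Ioo o.κμ_pos.le o.R_le hx))
    (fun x hx => by
      have h1 := (o.mono hx.1.le hx.2.le).mass_le
      have h2 := (o.mono hx.1.le hx.2.le).le_q_self
      linarith)
  have h1 := h.τ_nonneg o.core_mem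
  have h4 := mul_le_mul_of_nonneg_left o.core_div hC
  have h5 := mul_nonneg hC (div_nonneg o.μ_pos.le (o.κμ_pos.le.trans o.le_R))
  have h6 := o.small
  have h7 := o.δ_le
  have h8 := mul_nonneg h.ℓ_nonneg (sq_nonneg (κ * μ))
  have h9 := sq_nonneg κ
  unfold fluxConst
  linarith

end Bubble

theorem two_mul_log_le_tG {μ r : ℝ} (hμ : 0 < μ) (hr : 0 < r) :
    2 * (Real.log r - Real.log μ) ≤ tG μ r := by
  have h1 : 2 * (Real.log r - Real.log μ) = Real.log (r ^ 2 / μ ^ 2) := by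
    rw [Real.log_div (by positivity) (by positivity), Real.log_pow, Real.log_pow]
    push_cast
    ring
  rw [h1, tG]
  exact Real.log_le_log (by positivity) (by linarith)

theorem tG_le_two_mul_log {μ r : ℝ} (hμ : 0 < μ) (hr : μ ≤ r) :
    tG μ r ≤ 2 * (Real.log r - Real.log μ) + 1 := by
  have hr0 : 0 < r := hμ.trans_le hr
  have h1 : 2 * (Real.log r - Real.log μ) = Real.log (r ^ 2 / μ ^ 2) := by
    rw [Real.log_div (by positivity) (by positivity), Real.log_pow, Real.log_pow]
    push_cast
    ring
  have h2 : 1 ≤ r ^ 2 / μ ^ 2 := by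
    rw [one_le_div (by positivity)]
    exact pow_le_pow_left₀ hμ.le hr 2
  have h3 : Real.log 2 ≤ 1 := by linarith [Real.log_two_lt_d9]
  have h4 : tG μ r ≤ Real.log (2 * (r ^ 2 / μ ^ 2)) :=
    Real.log_le_log (by positivity) (by linarith)
  rw [Real.log_mul (by norm_num) (by positivity)] at h4
  linarith

theorem tG_nonneg (μ r : ℝ) : 0 ≤ tG μ r :=
  Real.log_nonneg (by have : 0 ≤ r ^ 2 / μ ^ 2 := by positivity
                      linarith)

theorem tG_mono (μ : ℝ) {a b : ℝ} (ha : 0 ≤ a) (hab : a ≤ b) : tG μ a ≤ tG μ b := by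
  have h1 : 0 ≤ a ^ 2 / μ ^ 2 := by positivity
  refine Real.log_le_log (by linarith) ?_
  have := div_le_div_of_nonneg_right (pow_le_pow_left₀ ha hab 2) (sq_nonneg μ)
  linarith

theorem sq_div_sq_le_exp_tG (μ r : ℝ) : r ^ 2 / μ ^ 2 ≤ Real.exp (tG μ r) := by
  have h1 : 0 ≤ r ^ 2 / μ ^ 2 := by positivity
  rw [tG, Real.exp_log (by linarith)]
  linarith

namespace Bubble

variable {δ ℓ m μ κ γ r₁ R : ℝ} {τ q : ℝ → ℝ}

/-- Lower deviation of `τ` from the bubble in the tail region. -/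
def tailDev (κ : ℝ) : ℝ := fluxConst κ + 122

/-- Constant in the exponential smallness of the nonlinear density in the tail region. -/
def tailConst (κ : ℝ) : ℝ := 4 * Real.exp (2 * tailDev κ + 1)

/-- The tail region `[r₁, R]`, where the bubble profile lies between `γ` and `γ² - γ`. -/
structure Tail (δ ℓ μ κ γ : ℝ) (τ q : ℝ → ℝ) (r₁ R : ℝ) : Prop where
  outer : Outer δ ℓ μ κ τ q r₁
  one_le_γ : 1 ≤ γ
  δ_mul : δ * γ ^ 2 = 1
  log_κ : Real.log κ = 60
  t_left : tG μ r₁ = γ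
  left_le : r₁ ≤ R
  R_le : R ≤ 1
  t_right : tG μ R ≤ γ ^ 2 - γ
  decay : decayConst κ * (μ / r₁) ≤ δ
  sq_le : ∀ r ∈ Icc r₁ R, r ^ 2 ≤ bubbleMass δ (4 / μ ^ 2) τ r

theorem Outer.left_pos (o : Outer δ ℓ μ κ τ q R) : 0 < R := o.κμ_pos.trans_le o.le_R

theorem Outer.μ_le (o : Outer δ ℓ μ κ τ q R) : μ ≤ R :=
  (le_mul_of_one_le_left o.μ_pos.le o.one_le_κ).trans o.le_R

theorem Tail.mono (T : Tail δ ℓ μ κ γ τ q r₁ R) {r : ℝ} (hr : r₁ ≤ r) (hrR : r ≤ R) :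
    Tail δ ℓ μ κ γ τ q r₁ r where
  outer := T.outer
  one_le_γ := T.one_le_γ
  δ_mul := T.δ_mul
  log_κ := T.log_κ
  t_left := T.t_left
  left_le := hr
  R_le := hrR.trans T.R_le
  t_right := (tG_mono μ (T.outer.left_pos.le.trans hr) hrR).trans T.t_right
  decay := T.decay
  sq_le := fun x hx => T.sq_le x ⟨hx.1, hx.2.trans hrR⟩

theorem Tail.log_le (T : Tail δ ℓ μ κ γ τ q r₁ R) :
    2 * (Real.log R - Real.log r₁) ≤ γ ^ 2 := by
  have h1 := two_mul_log_le_tG T.outer.μ_pos (T.outer.left_pos.trans_le T.left_le)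
  have h2 := tG_le_two_mul_log T.outer.μ_pos T.outer.μ_le
  have h3 := T.t_right
  have h4 := T.t_left
  have h5 := T.one_le_γ
  linarith

theorem Tail.log_nonneg (T : Tail δ ℓ μ κ γ τ q r₁ R) :
    0 ≤ Real.log R - Real.log r₁ :=
  sub_nonneg.2 (Real.log_le_log T.outer.left_pos T.left_le)

theorem Tail.log_core (T : Tail δ ℓ μ κ γ τ q r₁ R) :
    Real.log (κ * μ) = 60 + Real.log μ := by
  rw [Real.log_mul (by linarith [T.outer.one_le_κ]) T.outer.μ_pos.ne', T.log_κ]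

theorem Tail.tG_sub_le_τ (T : Tail δ ℓ μ κ γ τ q r₁ R) : tG μ R - tailDev κ ≤ τ R := by
  have o := T.outer
  have h := o.bubble
  have hq : 2 - 2 * δ ≤ q r₁ := by
    have h1 := o.le_q_self
    have h2 := o.mass_le
    have h3 := T.decay
    have h4 := o.small
    linarith
  have := sub_le_sub_of_logDeriv_le
    (F := fun r => (2 - 2 * δ) * Real.log r) T.left_le o.left_pos.le
    (continuousOn_mul_log _ o.left_pos)
    (h.τ_cont.mono (Icc_subset_Icc o.left_pos.le T.R_le))
    (fun x hx => hasDerivAt_mul_log _ (o.left_pos.trans hx.1))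
    (fun x hx => h.τ_deriv x (Ioo_subset_Ioo o.left_pos.le T.R_le hx))
    (fun x hx => hq.trans (h.q_le_q o.left_pos.le hx.1.le (hx.2.le.trans T.R_le)))
  have h1 := o.le_τ
  have h2 := mul_le_mul_of_nonneg_left T.log_le h.δ_nonneg
  have h3 := tG_le_two_mul_log o.μ_pos (o.μ_le.trans T.left_le)
  have h4 := T.log_core
  have h5 := T.δ_mul
  unfold tailDev
  linarith

theorem Tail.mass_le (T : Tail δ ℓ μ κ γ τ q r₁ R) :
    bubbleMass δ (4 / μ ^ 2) τ R ≤ tailConst κ * Real.exp (-γ) := by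
  have o := T.outer
  have h := o.bubble
  have hR : R ∈ Icc (0 : ℝ) 1 := ⟨o.left_pos.le.trans T.left_le, T.R_le⟩
  have h0 := h.τ_nonneg hR
  have ht0 := tG_nonneg μ R
  have hC : 0 ≤ tailDev κ := by
    have := fluxConst_nonneg o.one_le_κ
    unfold tailDev; linarith
  set t := tG μ R with ht
  have h1 : 2 * t - δ * t ^ 2 - 2 * tailDev κ ≤ 2 * τ R - δ * τ R ^ 2 := by
    rcases le_total t (τ R) with hle | hle
    · linarith [two_mul_sub_mono h.δ_nonneg (h.τ_le R hR) hle]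
    · have h2 := T.tG_sub_le_τ
      have h3 := mul_nonneg h.δ_nonneg (mul_nonneg (sub_nonneg.2 hle) (add_nonneg ht0 h0))
      nlinarith
  have h2 : γ - 1 ≤ t - δ * t ^ 2 := by
    have h3 : γ ≤ t := by
      rw [ht, ← T.t_left]
      exact tG_mono μ o.left_pos.le T.left_le
    have h4 := T.δ_mul
    have h5 := mul_nonneg h.δ_nonneg (mul_nonneg (sub_nonneg.2 h3) (sub_nonneg.2 T.t_right))
    have h6 := T.one_le_γ
    linear_combination h5 + h4 * (t - γ + 1)
  calc bubbleMass δ (4 / μ ^ 2) τ R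
      = 4 * (R ^ 2 / μ ^ 2) * Real.exp (-(2 * τ R - δ * τ R ^ 2)) := by
        unfold bubbleMass; ring
    _ ≤ 4 * Real.exp t * Real.exp (-(2 * t - δ * t ^ 2 - 2 * tailDev κ)) := by
        gcongr
        exact sq_div_sq_le_exp_tG μ R
    _ = 4 * Real.exp (2 * tailDev κ - (t - δ * t ^ 2)) := by
        rw [mul_assoc, ← Real.exp_add]; ring_nf
    _ ≤ 4 * Real.exp (2 * tailDev κ + 1 + -γ) := by
        gcongr
        linarith
    _ = _ := by rw [Real.exp_add, tailConst]; ring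

theorem Tail.q_sub_le (T : Tail δ ℓ μ κ γ τ q r₁ R) :
    q R - q r₁ ≤ (1 + ℓ) * tailConst κ * Real.exp (-γ) * γ ^ 2 := by
  have o := T.outer
  have h := o.bubble
  have hc : 0 ≤ (1 + ℓ) * (tailConst κ * Real.exp (-γ)) :=
    mul_nonneg (by linarith [h.ℓ_nonneg]) ((h.mass_nonneg R).trans T.mass_le)
  have := sub_le_sub_of_logDeriv_le
    (G := fun r => (1 + ℓ) * (tailConst κ * Real.exp (-γ)) * Real.log r)
    T.left_le o.left_pos.le
    (h.q_cont.mono (Icc_subset_Icc o.left_pos.le T.R_le))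
    (continuousOn_mul_log _ o.left_pos)
    (fun x hx => h.q_deriv x (Ioo_subset_Ioo o.left_pos.le T.R_le hx))
    (fun x hx => hasDerivAt_mul_log _ (o.left_pos.trans hx.1))
    (fun x hx => by
      have h1 := (T.mono hx.1.le hx.2.le).mass_le
      have h2 := mul_le_mul_of_nonneg_left (T.sq_le x (Ioo_subset_Icc_self hx)) h.ℓ_nonneg
      have h3 := h.flux_density_le (r := x)
        ⟨o.left_pos.le.trans hx.1.le, hx.2.le.trans T.R_le⟩
      have h4 := mul_le_mul_of_nonneg_left h1 (by linarith [h.ℓ_nonneg] : 0 ≤ 1 + ℓ)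
      linarith)
  have h1 : Real.log R - Real.log r₁ ≤ γ ^ 2 := by linarith [T.log_le, T.log_nonneg]
  have h2 := mul_le_mul_of_nonneg_left h1 hc
  linarith

theorem Tail.τ_le (T : Tail δ ℓ μ κ γ τ q r₁ R)
    (hsmall : (1 + ℓ) * tailConst κ * Real.exp (-γ) * γ ^ 2 ≤ δ) :
    τ R ≤ tG μ R + (fluxConst κ + 2 * sharpConst κ + 1) := by
  have o := T.outer
  have h := o.bubble
  have hS := sharpConst_nonneg o.one_le_κ
  have := sub_le_sub_of_logDeriv_le
    (G := fun r => (2 + (sharpConst κ + 1) * δ) * Real.log r) T.left_le o.left_pos.le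
    (h.τ_cont.mono (Icc_subset_Icc o.left_pos.le T.R_le))
    (continuousOn_mul_log _ o.left_pos)
    (fun x hx => h.τ_deriv x (Ioo_subset_Ioo o.left_pos.le T.R_le hx))
    (fun x hx => hasDerivAt_mul_log _ (o.left_pos.trans hx.1))
    (fun x hx => by
      have h1 := (T.mono hx.1.le hx.2.le).q_sub_le
      have h2 := o.q_le_two_add
      linarith)
  have h1 := o.τ_sub_le
  have h2 : Real.log R - Real.log r₁ ≤ γ ^ 2 := by linarith [T.log_le, T.log_nonneg]
  have h3 := mul_le_mul_of_nonneg_left h2 h.δ_nonneg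
  rw [T.δ_mul] at h3
  have h4 := mul_le_mul_of_nonneg_left h3 (by linarith : 0 ≤ sharpConst κ + 1)
  have h5 := two_mul_log_le_tG o.μ_pos (o.left_pos.trans_le T.left_le)
  have h6 := T.log_core
  linarith

/-- Comparison with the bubble in the outer region. -/
theorem Outer.abs_sub_le (o : Outer δ ℓ μ κ τ q R) (hlog : Real.log κ = 60) :
    |τ R - tG μ R| ≤ tailDev κ + sharpConst κ := by
  have h1 := o.τ_sub_le
  have h2 := o.le_τ
  have h3 := two_mul_log_le_tG o.μ_pos o.left_pos
  have h4 := tG_le_two_mul_log o.μ_pos o.μ_le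
  have h5 : Real.log (κ * μ) = 60 + Real.log μ := by
    rw [Real.log_mul (by linarith [o.one_le_κ]) o.μ_pos.ne', hlog]
  have h6 := sharpConst_nonneg o.one_le_κ
  have h7 := fluxConst_nonneg o.one_le_κ
  unfold tailDev
  rw [abs_le]
  constructor <;> linarith

/-- Comparison with the bubble in the core. -/
theorem abs_sub_le_core (h : Bubble δ ℓ (4 / μ ^ 2) τ q) (hμ : 0 < μ) (hκ : 1 ≤ κ) {r : ℝ}
    (hr : r ∈ Icc (0 : ℝ) 1) (hrκ : r ≤ κ * μ) (hℓ : ℓ * (κ * μ) ^ 2 ≤ 1) :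
    |τ r - tG μ r| ≤ fluxConst κ := by
  have h1 := h.τ_nonneg hr
  have h2 := tG_nonneg μ r
  have h3 := h.τ_le_sq hr
  have hsq := pow_le_pow_left₀ hr.1 hrκ 2
  have hx : r ^ 2 / μ ^ 2 ≤ κ ^ 2 := by
    rw [div_le_iff₀ (by positivity)]
    nlinarith
  have h4 : tG μ r ≤ κ ^ 2 := by
    have := Real.log_le_sub_one_of_pos (x := 1 + r ^ 2 / μ ^ 2) (by positivity)
    unfold tG
    linarith
  have h5 := mul_le_mul_of_nonneg_left hsq h.ℓ_nonneg
  have h6 : 4 / μ ^ 2 * r ^ 2 = 4 * (r ^ 2 / μ ^ 2) := by ring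
  have h7 := decayConst_nonneg hκ
  have h8 := sq_nonneg κ
  unfold fluxConst
  rw [abs_le]
  constructor <;> linarith

/-- Testing the equation against a positive eigenfunction `v` with flux `Q`. -/
theorem testing_le (h : Bubble δ ℓ (4 / μ ^ 2) τ q) {v Q : ℝ → ℝ} {Λ D V c Pmax r₀ : ℝ}
    (hδD : δ * D = 1) (hend : δ * τ 1 = 1)
    (hv : ContinuousOn v (Icc 0 1)) (hQ : ContinuousOn Q (Icc 0 1)) (hQ0 : Q 0 = 0)
    (hv1 : v 1 = 0) (hv' : ∀ r ∈ Ioo (0 : ℝ) 1, HasDerivAt v (-(Q r) / r) r)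
    (hQ' : ∀ r ∈ Ioo (0 : ℝ) 1, HasDerivAt Q (r * (Λ * v r)) r)
    (hv0 : ∀ r ∈ Icc (0 : ℝ) 1, 0 ≤ v r) (hvV : ∀ r ∈ Icc (0 : ℝ) 1, v r ≤ V)
    (hcv : ∀ r ∈ Icc (1 / 4 : ℝ) (1 / 2), c ≤ v r) (he : 0 ≤ Λ * D - ℓ)
    (hr₀ : 0 < r₀) (hr₀4 : r₀ ≤ 1 / 4) (hr₀μ : r₀ ≤ μ)
    (hP : ∀ r ∈ Icc r₀ 1, bubbleMass δ (4 / μ ^ 2) τ r ≤ Pmax) :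
    (Λ * D - ℓ) * c * (1 - δ * τ (1 / 2)) * (3 / 32) ≤ V * (2 + Pmax * -Real.log r₀) := by
  have hμ : 0 < μ := hr₀.trans_le hr₀μ
  set e := Λ * D - ℓ with hedef
  set G : ℝ → ℝ := fun r => D * (1 - δ * τ r) * Q r - q r * v r with hGdef
  have hG : ContinuousOn G (Icc 0 1) :=
    ((continuousOn_const.mul (continuousOn_const.sub (continuousOn_const.mul h.τ_cont))).mul
      hQ).sub (h.q_cont.mul hv)
  have hG' : ∀ r ∈ Ioo (0 : ℝ) 1, HasDerivAt G
      ((v r * (1 - δ * τ r) * (e * r ^ 2 - bubbleMass δ (4 / μ ^ 2) τ r)) / r) r := by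
    intro r hr
    refine ((((((h.τ_deriv r hr).const_mul δ).const_sub 1).const_mul D).mul (hQ' r hr)).sub
      ((h.q_deriv r hr).mul (hv' r hr))).congr_deriv ?_
    have := hr.1.ne'
    rw [hedef]
    field_simp
    linear_combination (-(q r * Q r)) * hδD
  have hG0 : G 0 = 0 := by simp [hGdef, hQ0, h.q_zero]
  have hG1 : G 1 = 0 := by simp [hGdef, hv1, hend]
  have hA : ∀ r ∈ Icc (0 : ℝ) 1, 0 ≤ 1 - δ * τ r ∧ 1 - δ * τ r ≤ 1 := fun r hr =>
    ⟨sub_nonneg.2 (h.τ_le r hr), by linarith [mul_nonneg h.δ_nonneg (h.τ_nonneg hr)]⟩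
  have hlow : ∀ r ∈ Icc (0 : ℝ) 1, -(V * bubbleMass δ (4 / μ ^ 2) τ r) ≤
      v r * (1 - δ * τ r) * (e * r ^ 2 - bubbleMass δ (4 / μ ^ 2) τ r) := by
    intro r hr
    have h1 := mul_nonneg (mul_nonneg (hv0 r hr) (hA r hr).1) (mul_nonneg he (sq_nonneg r))
    have h2 : v r * (1 - δ * τ r) ≤ V := by
      have := mul_le_of_le_one_right (hv0 r hr) (hA r hr).2
      linarith [hvV r hr]
    have h3 := mul_le_mul_of_nonneg_right h2 (h.mass_nonneg r)
    linarith
  have hV : 0 ≤ V := (hv0 0 (by simp)).trans (hvV 0 (by simp))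
  have step : ∀ a b : ℝ, r₀ ≤ a → a ≤ b → b ≤ 1 →
      -(V * Pmax) * Real.log b - -(V * Pmax) * Real.log a ≤ G b - G a := by
    intro a b ha hab hb
    have ha0 := hr₀.trans_le ha
    refine sub_le_sub_of_logDeriv_le (F := fun r => -(V * Pmax) * Real.log r) hab ha0.le
      (continuousOn_mul_log _ ha0) (hG.mono (Icc_subset_Icc ha0.le hb))
      (fun x hx => hasDerivAt_mul_log _ (ha0.trans hx.1))
      (fun x hx => hG' x (Ioo_subset_Ioo ha0.le hb hx))
      (fun x hx => ?_)
    have hx1 := hx.2.le.trans hb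
    have := mul_le_mul_of_nonneg_left (hP x ⟨ha.trans hx.1.le, hx1⟩) hV
    linarith [hlow x ⟨ha0.le.trans hx.1.le, hx1⟩]
  have hcore : -(V * 2) ≤ G r₀ - G 0 := by
    have := sub_le_sub_of_logDeriv_le (F := fun r => -(V * (2 / μ ^ 2)) * r ^ 2) hr₀.le le_rfl
      (by fun_prop) (hG.mono (Icc_subset_Icc le_rfl (by linarith)))
      (fun x hx => hasDerivAt_mul_sq _ hx.1)
      (fun x hx => hG' x (Ioo_subset_Ioo le_rfl (by linarith) hx))
      (fun x hx => by
        have hx' : x ∈ Icc (0 : ℝ) 1 := ⟨hx.1.le, by linarith [hx.2]⟩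
        have h1 := mul_le_mul_of_nonneg_left (h.mass_le hx') hV
        have h2 : V * (4 / μ ^ 2 * x ^ 2) = 2 * (V * (2 / μ ^ 2)) * x ^ 2 := by ring
        linarith [hlow x hx'])
    have h1 : 2 / μ ^ 2 * r₀ ^ 2 ≤ 2 := by
      rw [div_mul_eq_mul_div, div_le_iff₀ (by positivity)]
      nlinarith
    have h2 := mul_le_mul_of_nonneg_left h1 hV
    linarith
  have hmid : e * c * (1 - δ * τ (1 / 2)) * (3 / 32)
      - V * Pmax * (Real.log (1 / 2) - Real.log (1 / 4)) ≤ G (1 / 2) - G (1 / 4) := by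
    have := sub_le_sub_of_logDeriv_le (a := 1 / 4) (b := 1 / 2)
      (F := fun r => e * c * (1 - δ * τ (1 / 2)) / 2 * r ^ 2 + -(V * Pmax) * Real.log r)
      (by norm_num) (by norm_num)
      ((by fun_prop : ContinuousOn _ _).add (continuousOn_mul_log _ (by norm_num)))
      (hG.mono (Icc_subset_Icc (by norm_num) (by norm_num)))
      (fun x hx => ((hasDerivAt_mul_sq _ (by linarith [hx.1])).add
        (hasDerivAt_mul_log _ (by linarith [hx.1]))).congr_deriv (add_div _ _ _).symm)
      (fun x hx => hG' x (Ioo_subset_Ioo (by norm_num) (by norm_num) hx))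
      (fun x hx => by
        have hx' : x ∈ Icc (0 : ℝ) 1 := ⟨by linarith [hx.1], by linarith [hx.2]⟩
        have h1 := mul_le_mul_of_nonneg_left (hP x ⟨by linarith [hx.1], hx'.2⟩) hV
        have h2 : v x * (1 - δ * τ x) ≤ V := by
          have := mul_le_of_le_one_right (hv0 x hx') (hA x hx').2
          linarith [hvV x hx']
        have h3 := mul_le_mul_of_nonneg_right h2 (h.mass_nonneg x)
        have h4 : 1 - δ * τ (1 / 2) ≤ 1 - δ * τ x := by
          have := mul_le_mul_of_nonneg_left
            (h.τ_le_τ hx'.1 hx.2.le (by norm_num)) h.δ_nonneg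
          linarith
        have h5 := mul_le_mul (hcv x (Ioo_subset_Icc_self hx)) h4
          (hA (1 / 2) ⟨by norm_num, by norm_num⟩).1 (hv0 x hx')
        have h6 := mul_le_mul_of_nonneg_right h5 (mul_nonneg he (sq_nonneg x))
        linarith)
    linarith
  have s1 := step r₀ (1 / 4) le_rfl hr₀4 (by norm_num)
  have s2 := step (1 / 2) 1 (by linarith) (by norm_num) le_rfl
  rw [Real.log_one] at s2
  linarith

theorem half_value_ge (h : Bubble δ ℓ m τ q) {r₀ : ℝ} (hend : δ * τ 1 = 1) (hr₀ : 0 < r₀)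
    (hr₀4 : r₀ ≤ 1 / 4) :
    (1 - δ * τ r₀) * Real.log 2 ≤ (1 - δ * τ (1 / 2)) * -Real.log r₀ := by
  have hl : Real.log (1 / 2 : ℝ) = -Real.log 2 := by
    rw [one_div, Real.log_inv]
  have hl2 : 0 < Real.log 2 := Real.log_pos (by norm_num)
  have h1 := sub_le_sub_of_logDeriv_le (G := fun r => q (1 / 2) * Real.log r)
    (by linarith : r₀ ≤ 1 / 2) hr₀.le
    (h.τ_cont.mono (Icc_subset_Icc hr₀.le (by norm_num))) (continuousOn_mul_log _ hr₀)
    (fun x hx => h.τ_deriv x (Ioo_subset_Ioo hr₀.le (by norm_num) hx))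
    (fun x hx => hasDerivAt_mul_log _ (hr₀.trans hx.1))
    (fun x hx => h.q_le_q (hr₀.trans hx.1).le hx.2.le (by norm_num))
  have h2 := sub_le_sub_of_logDeriv_le (F := fun r => q (1 / 2) * Real.log r)
    (by norm_num : (1 / 2 : ℝ) ≤ 1) (by norm_num)
    (continuousOn_mul_log _ (by norm_num))
    (h.τ_cont.mono (Icc_subset_Icc (by norm_num) le_rfl))
    (fun x hx => hasDerivAt_mul_log _ (by linarith [hx.1]))
    (fun x hx => h.τ_deriv x (Ioo_subset_Ioo (by norm_num) le_rfl hx))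
    (fun x hx => h.q_le_q (by norm_num) hx.1.le hx.2.le)
  simp only [hl, Real.log_one] at h1 h2
  have h3 : Real.log r₀ ≤ -Real.log 2 := by
    rw [← hl]
    exact Real.log_le_log hr₀ (by linarith)
  have h4 := mul_le_mul_of_nonneg_left h1 h.δ_nonneg
  have h5 := mul_le_mul_of_nonneg_left h2 h.δ_nonneg
  have h6 := mul_le_mul_of_nonneg_right h4 hl2.le
  have h7 := mul_le_mul_of_nonneg_right h5 (by linarith : 0 ≤ -Real.log 2 - Real.log r₀)
  have h8 : δ * τ 1 * (Real.log r₀ + Real.log 2) = Real.log r₀ + Real.log 2 := by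
    rw [hend, one_mul]
  linear_combination h6 + h7 - h8

end Bubble

theorem exp_sub_sq_mul {γ x : ℝ} (hγ : 0 < γ) :
    Real.exp (γ ^ 2) *
      Real.exp (-(2 * (γ * (γ - x)) - (γ ^ 2)⁻¹ * (γ * (γ - x)) ^ 2)) = Real.exp (x ^ 2) := by
  rw [← Real.exp_add]
  congr 1
  field_simp
  ring

/-- Rescaling a radial solution. -/
theorem IsRadSol.exists_bubble {lam b γ μ : ℝ} {u : ℝ → ℝ} (hu : IsRadSol lam b γ u)
    (hγ : 0 < γ) (hlam : 0 ≤ lam) (hμ : 0 < μ)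
    (hμ4 : b * γ ^ 2 * Real.exp (γ ^ 2) * μ ^ 2 = 4) :
    ∃ q : ℝ → ℝ, Bubble (γ ^ 2)⁻¹ (lam * γ ^ 2) (4 / μ ^ 2) (fun r => γ * (γ - u r)) q ∧
      (∀ r ∈ Ioo (0 : ℝ) 1, HasDerivAt q (γ * (r * radLap u r)) r) ∧
      ∀ r, bubbleMass (γ ^ 2)⁻¹ (4 / μ ^ 2) (fun r => γ * (γ - u r)) r =
        γ ^ 2 * r ^ 2 * (b * Real.exp (u r ^ 2)) := by
  obtain ⟨hsm, heq, hpos, h1, h0⟩ := hu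
  obtain ⟨Q, hQc, hQ0, hu', hQ'⟩ := exists_radial_flux hsm (fun r _ => rfl)
  have hm : 4 / μ ^ 2 = b * γ ^ 2 * Real.exp (γ ^ 2) := by
    rw [← hμ4]; field_simp
  have hmass : ∀ r, bubbleMass (γ ^ 2)⁻¹ (4 / μ ^ 2) (fun r => γ * (γ - u r)) r =
      γ ^ 2 * r ^ 2 * (b * Real.exp (u r ^ 2)) := by
    intro r
    rw [bubbleMass, hm, ← exp_sub_sq_mul (x := u r) hγ]
    ring
  refine ⟨fun r => γ * Q r, ⟨by positivity, by positivity, by positivity, ?_, ?_, ?_, ?_, ?_,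
    ?_, ?_⟩, fun r hr => (hQ' r hr).const_mul γ, hmass⟩
  · exact continuousOn_const.mul (continuousOn_const.sub hsm.continuousOn)
  · exact continuousOn_const.mul hQc
  · simp [h0]
  · simp [hQ0]
  · intro r hr
    have hur : 0 ≤ u r := by
      rcases hr.2.lt_or_eq with hlt | rfl
      · exact (hpos r ⟨hr.1, hlt⟩).le
      · exact h1.ge
    rw [inv_mul_le_iff₀ (by positivity)]
    nlinarith
  · intro r hr
    refine (((hu' r hr).const_sub γ).const_mul γ).congr_deriv ?_
    ring
  · intro r hr
    refine ((hQ' r hr).const_mul γ).congr_deriv ?_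
    have := hr.1.ne'
    rw [hmass, heq r hr]
    field_simp
    ring

namespace Bubble

variable {δ ℓ μ κ γ Λ R r₁ : ℝ} {τ q : ℝ → ℝ}

/-- The nonlinear density stays bounded if the bubble is not concentrated. -/
theorem mass_le_of_le_scale (h : Bubble δ ℓ (4 / μ ^ 2) τ q) {r₀ : ℝ} (hr₀ : 0 < r₀)
    (hr₀μ : r₀ ≤ μ) (hlog : 4 * δ * Real.log r₀ ^ 2 ≤ 1) {r : ℝ} (hr : r ∈ Icc r₀ 1) :
    bubbleMass δ (4 / μ ^ 2) τ r ≤ 20 := by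
  have hμ : 0 < μ := hr₀.trans_le hr₀μ
  have hr0 : 0 < r := hr₀.trans_le hr.1
  have hr01 : r ∈ Icc (0 : ℝ) 1 := ⟨hr0.le, hr.2⟩
  have hm : 4 / μ ^ 2 * r₀ ^ 2 ≤ 4 := by
    rw [div_mul_eq_mul_div, div_le_iff₀ (by positivity)]
    nlinarith
  rcases le_total (τ r) (2 * -Real.log r₀) with hτ | hτ
  · have h1 := h.mass_growth (k := 4 * δ * -Real.log r₀) hr₀ hr.1 hr.2
      (by nlinarith [mul_le_mul_of_nonneg_left hτ h.δ_nonneg])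
    have h2 : Real.log r ≤ 0 := Real.log_nonpos hr0.le hr.2
    have h3 : Real.log r₀ ≤ 0 := Real.log_nonpos hr₀.le (hr.1.trans hr.2)
    have h4 : 4 * δ * -Real.log r₀ * (Real.log r - Real.log r₀) ≤ 1 := by
      have := mul_le_mul_of_nonneg_left h2
        (mul_nonneg (mul_nonneg zero_le_four h.δ_nonneg) (neg_nonneg.2 h3))
      nlinarith
    have h5 : Real.exp (4 * δ * -Real.log r₀ * (Real.log r - Real.log r₀)) ≤ 3 :=
      (Real.exp_le_exp.2 h4).trans (by linarith [Real.exp_one_lt_d9])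
    have h6 := Real.exp_pos (4 * δ * -Real.log r₀ * (Real.log r - Real.log r₀))
    nlinarith
  · have h1 := h.mass_le_mul_exp hr01
    have h2 : Real.exp (-τ r) ≤ r₀ ^ 2 := by
      calc Real.exp (-τ r) ≤ Real.exp (Real.log r₀ + Real.log r₀) :=
            Real.exp_le_exp.2 (by linarith)
        _ = r₀ ^ 2 := by rw [Real.exp_add, Real.exp_log hr₀, sq]
    have h3 : r ^ 2 ≤ 1 := pow_le_one₀ hr0.le hr.2
    have h4 := mul_le_mul_of_nonneg_left h2 (mul_nonneg h.m_nonneg (sq_nonneg r))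
    have h5 := mul_le_mul hm h3 (sq_nonneg r) (by norm_num)
    linarith

/-- A spectral gap below the eigenvalue forces concentration of the bubble. -/
theorem scale_lt (h : Bubble δ ℓ (4 / μ ^ 2) τ q) {v Q : ℝ → ℝ} {D V c r₀ : ℝ} (hμ : 0 < μ)
    (hδD : δ * D = 1) (hend : δ * τ 1 = 1)
    (hv : ContinuousOn v (Icc 0 1)) (hQ : ContinuousOn Q (Icc 0 1)) (hQ0 : Q 0 = 0)
    (hv1 : v 1 = 0) (hv' : ∀ r ∈ Ioo (0 : ℝ) 1, HasDerivAt v (-(Q r) / r) r)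
    (hQ' : ∀ r ∈ Ioo (0 : ℝ) 1, HasDerivAt Q (r * (Λ * v r)) r)
    (hv0 : ∀ r ∈ Icc (0 : ℝ) 1, 0 ≤ v r) (hvV : ∀ r ∈ Icc (0 : ℝ) 1, v r ≤ V)
    (hc : 0 ≤ c) (hcv : ∀ r ∈ Icc (1 / 4 : ℝ) (1 / 2), c ≤ v r) (he : 0 ≤ Λ * D - ℓ)
    (hr₀ : 0 < r₀) (hr₀4 : r₀ ≤ 1 / 4) (hlog : 4 * δ * Real.log r₀ ^ 2 ≤ 1)
    (hΛ : Λ * r₀ ^ 2 ≤ 1) (hδ : δ ≤ 1 / 4)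
    (hgap : 128 * (V * (2 + 20 * -Real.log r₀) * -Real.log r₀) < 3 * ((Λ * D - ℓ) * c)) :
    μ < r₀ := by
  by_contra! hr₀μ
  have hP := fun r (hr : r ∈ Icc r₀ 1) => h.mass_le_of_le_scale hr₀ hr₀μ hlog hr
  have h1 := h.testing_le hδD hend hv hQ hQ0 hv1 hv' hQ' hv0 hvV hcv he hr₀ hr₀4 hr₀μ hP
  have h2 := h.half_value_ge hend hr₀ hr₀4
  have hm : 4 / μ ^ 2 * r₀ ^ 2 ≤ 4 := by
    rw [div_mul_eq_mul_div, div_le_iff₀ (by positivity)]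
    nlinarith
  have hδℓ : δ * ℓ ≤ Λ := by
    have := mul_le_mul_of_nonneg_left (sub_nonneg.1 he) h.δ_nonneg
    linear_combination this + Λ * hδD
  have h3 : δ * τ r₀ ≤ 1 / 2 := by
    have h4 := mul_le_mul_of_nonneg_left
      (h.τ_le_sq (r := r₀) ⟨hr₀.le, by linarith⟩) h.δ_nonneg
    have h5 := mul_le_mul_of_nonneg_right hδℓ (sq_nonneg r₀)
    have h6 := mul_le_mul_of_nonneg_left hm h.δ_nonneg
    linarith
  have hN : 0 ≤ -Real.log r₀ := neg_nonneg.2 (Real.log_nonpos hr₀.le (by linarith))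
  have hec : 0 ≤ (Λ * D - ℓ) * c := mul_nonneg he hc
  have h4 : 1 / 2 * (1 / 2) ≤ (1 - δ * τ (1 / 2)) * -Real.log r₀ := by
    refine le_trans (mul_le_mul (by linarith) ?_ (by norm_num) (by linarith)) h2
    linarith [Real.log_two_gt_d9]
  have h5 := mul_le_mul_of_nonneg_left h4 hec
  have h6 := mul_le_mul_of_nonneg_right h1 hN
  linarith

/-- Largeness conditions on the height `γ`. -/
structure LargeHeight (κ Λ γ : ℝ) : Prop where
  one_le : 1 ≤ γ
  core : 2 * (κ ^ 2 + 1) ≤ γ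
  core_linear : 50 * (Λ * κ ^ 2) ≤ γ
  outer : Λ * decayConst κ ^ 2 ≤ γ
  decay : decayConst κ ^ 2 * γ ^ 4 + 1 ≤ Real.exp γ
  tail : (1 + Λ * γ ^ 2) * tailConst κ * Real.exp (-γ) * γ ^ 4 ≤ 1

/-- A concentrated bubble of large height, on a disk where the nonlinear term dominates. -/
structure Concentrated (δ ℓ μ κ γ Λ : ℝ) (τ q : ℝ → ℝ) (R : ℝ) : Prop where
  bubble : Bubble δ ℓ (4 / μ ^ 2) τ q
  large : LargeHeight κ Λ γ
  one_le_κ : 1 ≤ κ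
  log_κ : Real.log κ = 60
  μ_pos : 0 < μ
  δ_mul : δ * γ ^ 2 = 1
  Λ_nonneg : 0 ≤ Λ
  ℓ_le : ℓ ≤ Λ * γ ^ 2
  μ_mul_le : μ * γ ^ 9 ≤ 1
  R_le : R ≤ 1
  t_le : tG μ R ≤ γ ^ 2 - γ
  sq_le : ∀ r ∈ Icc 0 R, r ^ 2 ≤ bubbleMass δ (4 / μ ^ 2) τ r

theorem one_le_decayConst (hκ : 1 ≤ κ) : 1 ≤ decayConst κ := by
  have h1 : 1 ≤ Real.exp 3 := Real.one_le_exp (by norm_num)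
  have h2 : 1 ≤ κ ^ 3 := one_le_pow₀ hκ
  unfold decayConst
  nlinarith

namespace Concentrated

theorem δ_mul_le (K : Concentrated δ ℓ μ κ γ Λ τ q R) : δ * γ ≤ 1 := by
  have h1 := K.large.one_le
  have h2 := mul_nonneg (mul_nonneg K.bubble.δ_nonneg (zero_le_one.trans h1))
    (sub_nonneg.2 h1)
  have h3 := K.δ_mul
  linarith

theorem μ_mul_pow_le (K : Concentrated δ ℓ μ κ γ Λ τ q R) {n : ℕ} (hn : n ≤ 9) :
    μ * γ ^ n ≤ 1 :=
  (mul_le_mul_of_nonneg_left (pow_le_pow_right₀ K.large.one_le hn) K.μ_pos.le).trans K.μ_mul_le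

theorem core_mul_le (K : Concentrated δ ℓ μ κ γ Λ τ q R) : κ * μ ≤ 1 := by
  have h1 := K.μ_mul_pow_le (n := 1) (by norm_num)
  have h2 := K.large.core
  have h3 := K.one_le_κ
  have h4 : κ ≤ γ := by nlinarith
  have h5 := mul_le_mul_of_nonneg_right h4 K.μ_pos.le
  linarith

theorem ℓ_core_le (K : Concentrated δ ℓ μ κ γ Λ τ q R) : ℓ * (κ * μ) ^ 2 ≤ 1 / 50 := by
  have h1 := mul_le_mul_of_nonneg_right K.ℓ_le (sq_nonneg (κ * μ))
  have h2 := mul_le_mul_of_nonneg_right K.large.core_linear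
    (by positivity : 0 ≤ γ ^ 2 * μ ^ 2)
  have h3 : μ * γ ^ 2 * (μ * γ ^ 1) ≤ 1 :=
    mul_le_one₀ (K.μ_mul_pow_le (by norm_num))
      (mul_nonneg K.μ_pos.le (pow_nonneg (by linarith [K.large.one_le]) _))
      (K.μ_mul_pow_le (by norm_num))
  linarith

theorem le_q (K : Concentrated δ ℓ μ κ γ Λ τ q R) : 3 / 2 ≤ q (κ * μ) := by
  refine K.bubble.three_halves_le_q K.μ_pos K.one_le_κ K.log_κ K.core_mul_le K.ℓ_core_le ?_
  have h1 := mul_le_mul_of_nonneg_left K.large.core K.bubble.δ_nonneg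
  have h2 := K.δ_mul_le
  linarith

theorem log_core (K : Concentrated δ ℓ μ κ γ Λ τ q R) :
    Real.log (κ * μ) = 60 + Real.log μ := by
  rw [Real.log_mul (by linarith [K.one_le_κ]) K.μ_pos.ne', K.log_κ]

theorem core_pos (K : Concentrated δ ℓ μ κ γ Λ τ q R) : 0 < κ * μ :=
  mul_pos (zero_lt_one.trans_le K.one_le_κ) K.μ_pos

/-- Up to the height `γ` of the bubble profile, the linear term is negligible. -/
theorem outer (K : Concentrated δ ℓ μ κ γ Λ τ q R) {r : ℝ} (hr : κ * μ ≤ r) (hrR : r ≤ R)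
    (ht : tG μ r ≤ γ) : Outer δ ℓ μ κ τ q r := by
  have hγ := K.large.one_le
  have hr0 : 0 < r := K.core_pos.trans_le hr
  have hz : δ * (Real.log r - Real.log (κ * μ)) ^ 2 ≤ 1 := by
    have h1 := two_mul_log_le_tG K.μ_pos hr0
    have h2 := K.log_core
    have h3 : 0 ≤ Real.log r - Real.log (κ * μ) :=
      sub_nonneg.2 (Real.log_le_log K.core_pos hr)
    have h4 : Real.log r - Real.log (κ * μ) ≤ γ := by linarith
    have h5 := mul_le_mul_of_nonneg_left (pow_le_pow_left₀ h3 h4 2) K.bubble.δ_nonneg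
    linarith [K.δ_mul]
  refine ⟨K.bubble, K.μ_pos, K.one_le_κ, hr, hrR.trans K.R_le, K.le_q, ?_, hz, ?_⟩
  · nlinarith [K.δ_mul_le, K.bubble.δ_nonneg]
  have hB := one_le_decayConst K.one_le_κ
  have h1 : r ^ 2 ≤ decayConst κ * (μ / r) :=
    (K.sq_le r ⟨hr0.le, hrR⟩).trans
      (K.bubble.mass_decay K.μ_pos K.one_le_κ K.le_q hr (hrR.trans K.R_le) hz)
  have h2 : r ^ 3 ≤ decayConst κ * μ := by
    have := mul_le_mul_of_nonneg_right h1 hr0.le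
    rw [mul_assoc, div_mul_cancel₀ _ hr0.ne'] at this
    linarith
  have h3 : (r * γ ^ 3) ^ 3 ≤ decayConst κ ^ 3 := by
    have h4 := mul_le_mul_of_nonneg_right h2 (by positivity : 0 ≤ γ ^ 9)
    have h5 := mul_le_mul_of_nonneg_left K.μ_mul_le (zero_le_one.trans hB)
    have h6 : decayConst κ ≤ decayConst κ ^ 3 := le_self_pow₀ hB (by norm_num)
    linarith
  have h4 : r * γ ^ 3 ≤ decayConst κ := le_of_pow_le_pow_left₀ (by norm_num) (by linarith) h3
  have h5 := mul_le_mul_of_nonneg_left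
    (pow_le_pow_left₀ (by positivity) h4 2) K.Λ_nonneg
  have h6 := K.large.outer
  have h7 := mul_le_mul_of_nonneg_right K.ℓ_le (by positivity : 0 ≤ r ^ 2 * γ ^ 4)
  have h8 : ℓ * r ^ 2 * γ ^ 4 ≤ δ * γ ^ 4 := by
    have : δ * γ ^ 4 = γ ^ 2 := by linear_combination γ ^ 2 * K.δ_mul
    rw [this]
    nlinarith
  exact le_of_mul_le_mul_right h8 (by positivity)

theorem core_le_left (K : Concentrated δ ℓ μ κ γ Λ τ q R) (hr₁ : 0 < r₁) (ht : tG μ r₁ = γ) :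
    κ * μ ≤ r₁ := by
  by_contra! hlt
  have h1 : r₁ ^ 2 / μ ^ 2 ≤ κ ^ 2 := by
    rw [div_le_iff₀ (by have := K.μ_pos; positivity), ← mul_pow]
    exact pow_le_pow_left₀ hr₁.le hlt.le 2
  have h2 : tG μ r₁ ≤ κ ^ 2 :=
    (Real.log_le_sub_one_of_pos (by positivity)).trans (by linarith)
  nlinarith [K.large.core]

theorem tail (K : Concentrated δ ℓ μ κ γ Λ τ q R) (hr₁ : 0 < r₁) (ht : tG μ r₁ = γ)
    (hR : r₁ ≤ R) : Tail δ ℓ μ κ γ τ q r₁ R where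
  outer := K.outer (K.core_le_left hr₁ ht) hR ht.le
  one_le_γ := K.large.one_le
  δ_mul := K.δ_mul
  log_κ := K.log_κ
  t_left := ht
  left_le := hR
  R_le := K.R_le
  t_right := K.t_le
  decay := by
    have hγ := K.large.one_le
    have hμ := K.μ_pos
    have h1 : 1 + r₁ ^ 2 / μ ^ 2 = Real.exp γ := by
      rw [← ht, tG, Real.exp_log (by positivity)]
    have h2 : (decayConst κ * γ ^ 2) ^ 2 ≤ (r₁ / μ) ^ 2 := by
      rw [div_pow]
      linarith [K.large.decay]
    have h3 : decayConst κ * γ ^ 2 ≤ r₁ / μ :=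
      le_of_pow_le_pow_left₀ (by norm_num) (by positivity) h2
    have h4 := mul_le_mul_of_nonneg_right h3 (by positivity : 0 ≤ μ / r₁)
    have h5 : r₁ / μ * (μ / r₁) = 1 := by field_simp
    have h6 : decayConst κ * (μ / r₁) * γ ^ 2 ≤ δ * γ ^ 2 := by
      rw [K.δ_mul]
      linarith
    exact le_of_mul_le_mul_right h6 (by positivity)
  sq_le := fun r hr => K.sq_le r ⟨hr₁.le.trans hr.1, hr.2⟩

theorem tail_const_le (K : Concentrated δ ℓ μ κ γ Λ τ q R) :
    (1 + ℓ) * tailConst κ * Real.exp (-γ) * γ ^ 2 ≤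
      (1 + Λ * γ ^ 2) * tailConst κ * Real.exp (-γ) * γ ^ 2 := by
  have : 0 ≤ tailConst κ := by unfold tailConst; positivity
  have := K.ℓ_le
  gcongr

theorem mono (K : Concentrated δ ℓ μ κ γ Λ τ q R) {r : ℝ} (hr : r ∈ Icc 0 R) :
    Concentrated δ ℓ μ κ γ Λ τ q r :=
  { K with
    R_le := hr.2.trans K.R_le
    t_le := (tG_mono μ hr.1 hr.2).trans K.t_le
    sq_le := fun x hx => K.sq_le x ⟨hx.1, hx.2.trans hr.2⟩ }

/-- The profile stays within a bounded distance of the bubble. -/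
theorem abs_sub_le (K : Concentrated δ ℓ μ κ γ Λ τ q R) (hr₁ : 0 < r₁) (ht : tG μ r₁ = γ)
    (hR : 0 ≤ R) : |τ R - tG μ R| ≤ tailDev κ + 2 * sharpConst κ := by
  have hs := sharpConst_nonneg K.one_le_κ
  have hf := fluxConst_nonneg K.one_le_κ
  rcases le_total R (κ * μ) with h1 | h1
  · refine (K.bubble.abs_sub_le_core K.μ_pos K.one_le_κ ⟨hR, K.R_le⟩ h1 ?_).trans ?_
    · linarith [K.ℓ_core_le]
    · unfold tailDev; linarith
  rcases le_total R r₁ with h2 | h2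
  · have := (K.outer h1 le_rfl (ht ▸ tG_mono μ hR h2)).abs_sub_le K.log_κ
    linarith
  · have T := K.tail hr₁ ht h2
    have h3 : (1 + ℓ) * tailConst κ * Real.exp (-γ) * γ ^ 2 ≤ δ := by
      refine K.tail_const_le.trans ?_
      have hγ := K.large.one_le
      have h4 : (1 + Λ * γ ^ 2) * tailConst κ * Real.exp (-γ) * γ ^ 2 * γ ^ 2 ≤ δ * γ ^ 2 := by
        rw [K.δ_mul]
        linarith [K.large.tail]
      exact le_of_mul_le_mul_right h4 (by positivity)
    have h4 := T.τ_le h3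
    have h5 := T.tG_sub_le_τ
    have h6 : fluxConst κ + 1 ≤ tailDev κ := by unfold tailDev; linarith
    rw [abs_le]
    constructor <;> linarith

end Concentrated

end Bubble

theorem eventually_largeHeight (κ Λ : ℝ) : ∀ᶠ γ in atTop, Bubble.LargeHeight κ Λ γ := by
  have e := Real.tendsto_pow_mul_exp_neg_atTop_nhds_zero
  have hd : Tendsto (fun γ : ℝ => Bubble.decayConst κ ^ 2 * (γ ^ 4 * Real.exp (-γ)) +
      γ ^ 0 * Real.exp (-γ)) atTop (𝓝 0) := by
    simpa using ((e 4).const_mul (Bubble.decayConst κ ^ 2)).add (e 0)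
  have ht : Tendsto (fun γ : ℝ => Bubble.tailConst κ * (γ ^ 4 * Real.exp (-γ)) +
      Λ * Bubble.tailConst κ * (γ ^ 6 * Real.exp (-γ))) atTop (𝓝 0) := by
    simpa using ((e 4).const_mul (Bubble.tailConst κ)).add
      ((e 6).const_mul (Λ * Bubble.tailConst κ))
  filter_upwards [eventually_ge_atTop 1, eventually_ge_atTop (2 * (κ ^ 2 + 1)),
    eventually_ge_atTop (50 * (Λ * κ ^ 2)), eventually_ge_atTop (Λ * Bubble.decayConst κ ^ 2),
    hd.eventually_le_const zero_lt_one, ht.eventually_le_const zero_lt_one]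
    with γ h1 h2 h3 h4 h5 h6
  refine ⟨h1, h2, h3, h4, ?_, by linarith⟩
  have h7 := mul_le_mul_of_nonneg_right h5 (Real.exp_pos γ).le
  have h8 : Real.exp (-γ) * Real.exp γ = 1 := by rw [← Real.exp_add]; simp
  linear_combination h7 + (-(Bubble.decayConst κ ^ 2 * γ ^ 4) - 1) * h8

theorem eventually_log_sq_lt (A B : ℝ) {ε : ℝ} (hε : 0 < ε) :
    ∀ᶠ γ in atTop, A * Real.log γ + B * Real.log γ ^ 2 < ε * γ := by
  have e : ∀ n : ℕ, Tendsto (fun γ : ℝ => Real.log γ ^ n / γ) atTop (𝓝 0) := fun n =>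
    (Real.isLittleO_pow_log_id_atTop (n := n)).tendsto_div_nhds_zero
  have h : Tendsto (fun γ : ℝ => A * (Real.log γ ^ 1 / γ) + B * (Real.log γ ^ 2 / γ)) atTop
      (𝓝 0) := by
    simpa only [mul_zero, add_zero] using ((e 1).const_mul A).add ((e 2).const_mul B)
  filter_upwards [h.eventually_lt_const hε, eventually_gt_atTop 0] with γ h1 h2
  have h3 := mul_lt_mul_of_pos_right h1 h2
  have h4 : (A * (Real.log γ ^ 1 / γ) + B * (Real.log γ ^ 2 / γ)) * γ =
      A * Real.log γ + B * Real.log γ ^ 2 := by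
    field_simp
  linarith

theorem lamBar_gap (lam1 v10 l : ℝ) {γ : ℝ} (hγ : 0 < γ) :
    lam1 * γ ^ 2 - lamBar lam1 v10 l γ * γ ^ 2 = 4 * π * v10 * Real.sqrt (lam1 / l) * γ := by
  unfold lamBar
  field_simp
  ring

theorem EigenCtx.gap_pos {lam1 : ℝ} {v1 : ℝ → ℝ} (hE : EigenCtx lam1 v1) {l : ℝ}
    (hl : 0 < l) : 0 < 4 * π * v1 0 * Real.sqrt (lam1 / l) := by
  obtain ⟨h1, -, -, h2, -, -⟩ := hE
  have h3 := h2 0 (by simp)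
  have := Real.pi_pos
  positivity

theorem EigenCtx.eventually_lamBar {lam1 : ℝ} {v1 : ℝ → ℝ} (hE : EigenCtx lam1 v1) {l : ℝ}
    (hl : 0 < l) :
    ∀ᶠ γ in atTop, 0 < lamBar lam1 (v1 0) l γ ∧ lamBar lam1 (v1 0) l γ ≤ lam1 := by
  have hc := hE.gap_pos hl
  filter_upwards [eventually_gt_atTop 0,
    eventually_gt_atTop (4 * π * v1 0 * Real.sqrt (lam1 / l) / lam1)] with γ h1 h2
  have h3 := lamBar_gap lam1 (v1 0) l h1
  rw [div_lt_iff₀ hE.1] at h2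
  constructor
  · refine pos_of_mul_pos_left (b := γ ^ 2) ?_ (by positivity)
    nlinarith
  · refine le_of_mul_le_mul_right (a := γ ^ 2) ?_ (by positivity)
    nlinarith

/-- The concentration scale is smaller than every fixed power needed below. -/
theorem eventually_scale_lt {lam1 : ℝ} {v1 : ℝ → ℝ} (hE : EigenCtx lam1 v1) {l : ℝ}
    (hl : 0 < l) {β : ℝ → ℝ} {u : ℝ → ℝ → ℝ} (hF : GoodFamily lam1 v1 l β u) {μ : ℝ → ℝ}
    (hμ : ∀ γ : ℝ, 0 < γ → 0 < lamBar lam1 (v1 0) l γ →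
      0 < μ γ ∧ β γ * γ ^ 2 * Real.exp (γ ^ 2) * (μ γ) ^ 2 = 4) :
    ∀ᶠ γ in atTop, μ γ < (γ ^ 9)⁻¹ := by
  have hgap := hE.gap_pos hl
  obtain ⟨hlam, hv, hveq, hvpos, hv1, -⟩ := id hE
  obtain ⟨Q, hQ, hQ0, hv', hQ'⟩ := exists_radial_flux hv hveq
  have hv0 : ∀ r ∈ Icc (0 : ℝ) 1, 0 ≤ v1 r := by
    intro r hr
    rcases hr.2.lt_or_eq with hlt | rfl
    · exact (hvpos r ⟨hr.1, hlt⟩).le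
    · exact hv1.ge
  obtain ⟨V, hV⟩ := isCompact_Icc.bddAbove_image hv.continuousOn
  have hvV : ∀ r ∈ Icc (0 : ℝ) 1, v1 r ≤ V := fun r hr => hV (mem_image_of_mem v1 hr)
  obtain ⟨x, hx, hxmin⟩ := isCompact_Icc.exists_isMinOn
    (nonempty_Icc.2 (by norm_num : (1 / 4 : ℝ) ≤ 1 / 2))
    (hv.continuousOn.mono (Icc_subset_Icc (by norm_num) (by norm_num)))
  have hc : 0 < v1 x := hvpos x ⟨by linarith [hx.1], by linarith [hx.2]⟩
  filter_upwards [eventually_ge_atTop 324, eventually_ge_atTop lam1, hE.eventually_lamBar hl,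
    eventually_log_sq_lt 0 1 one_pos,
    eventually_log_sq_lt (128 * V * 18) (128 * V * 1620)
      (by positivity : 0 < 3 * (4 * π * v1 0 * Real.sqrt (lam1 / l) * v1 x))]
    with γ h324 hlamγ hbar hlog1 hlog2
  have hγ : 0 < γ := by linarith
  obtain ⟨hβ, hu⟩ := hF γ hγ hbar.1
  obtain ⟨hμ0, hμ4⟩ := hμ γ hγ hbar.1
  obtain ⟨q, h, -, -⟩ := hu.exists_bubble hγ hbar.1.le hμ0 hμ4
  have hlog : Real.log ((γ ^ 9)⁻¹) = -(9 * Real.log γ) := by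
    rw [Real.log_inv, Real.log_pow]; push_cast; ring
  have hpow : γ ≤ γ ^ 9 := le_self_pow₀ (by linarith) (by norm_num)
  have hpow2 : γ ^ 1 ≤ γ ^ 2 := pow_le_pow_right₀ (by linarith) (by norm_num)
  have hinv : (γ ^ 9)⁻¹ ≤ γ⁻¹ := inv_anti₀ hγ hpow
  have hinv4 : γ⁻¹ ≤ 1 / 4 := by
    rw [inv_le_comm₀ hγ (by norm_num)]; linarith
  have hgapγ := lamBar_gap lam1 (v1 0) l hγ
  refine h.scale_lt (D := γ ^ 2) (Λ := lam1) (V := V) (c := v1 x) hμ0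
    (inv_mul_cancel₀ (by positivity)) ?_ hv.continuousOn hQ hQ0 hv1 hv' hQ' hv0 hvV hc.le
    (fun r hr => hxmin hr) ?_ (by positivity) (hinv.trans hinv4) ?_ ?_ ?_ ?_
  · rw [hu.2.2.2.1]
    field_simp
    ring
  · rw [hgapγ]
    positivity
  · rw [hlog, mul_right_comm, ← div_eq_mul_inv, div_le_one (by positivity)]
    nlinarith
  · have h1 : ((γ ^ 9)⁻¹) ^ 2 ≤ (γ⁻¹) ^ 1 := by
      calc ((γ ^ 9)⁻¹) ^ 2 ≤ (γ⁻¹) ^ 2 := pow_le_pow_left₀ (by positivity) hinv 2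
        _ ≤ (γ⁻¹) ^ 1 :=
          pow_le_pow_of_le_one (by positivity) (by linarith) (by norm_num)
    have h2 : lam1 * γ⁻¹ ≤ 1 := by
      rw [← div_eq_mul_inv, div_le_one hγ]; exact hlamγ
    have h3 := mul_le_mul_of_nonneg_left h1 hlam.le
    linarith
  · exact (inv_anti₀ hγ (by linarith)).trans hinv4
  · rw [hlog, hgapγ]
    linarith

/-- For large heights, the rescaled solution is a concentrated bubble up to the radius where the
nonlinear term stops dominating. -/
theorem eventually_concentrated {lam1 : ℝ} {v1 : ℝ → ℝ} (hE : EigenCtx lam1 v1) {l : ℝ}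
    (hl : 0 < l) {β : ℝ → ℝ} {u : ℝ → ℝ → ℝ} (hF : GoodFamily lam1 v1 l β u) {μ ρ r' : ℝ → ℝ}
    (hμ : ∀ γ : ℝ, 0 < γ → 0 < lamBar lam1 (v1 0) l γ →
      0 < μ γ ∧ β γ * γ ^ 2 * Real.exp (γ ^ 2) * (μ γ) ^ 2 = 4)
    (hρ : ∀ γ : ℝ, 0 < γ → 0 < lamBar lam1 (v1 0) l γ →
      0 < ρ γ ∧ tG (μ γ) (ρ γ) = γ ^ 2 - γ)
    (hr' : ∀ γ : ℝ, 0 < γ → 0 < lamBar lam1 (v1 0) l γ →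
      ((β γ < (γ ^ 2)⁻¹ ∧ (γ ^ 2)⁻¹ < β γ * Real.exp (γ ^ 2)) →
        r' γ ∈ Set.Ioo (0:ℝ) 1 ∧ β γ * Real.exp ((u γ (r' γ)) ^ 2) = (γ ^ 2)⁻¹) ∧
      (¬(β γ < (γ ^ 2)⁻¹ ∧ (γ ^ 2)⁻¹ < β γ * Real.exp (γ ^ 2)) → r' γ = 1)) :
    ∀ᶠ γ in atTop, 0 < γ ∧ 0 < lamBar lam1 (v1 0) l γ ∧ 0 ≤ min (ρ γ) (r' γ) ∧
      ∃ q : ℝ → ℝ, Bubble.Concentrated (γ ^ 2)⁻¹ (lamBar lam1 (v1 0) l γ * γ ^ 2) (μ γ)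
        (Real.exp 60) γ lam1 (fun r => γ * (γ - u γ r)) q (min (ρ γ) (r' γ)) ∧
        ∀ r ∈ Ioo (0 : ℝ) 1, HasDerivAt q (γ * (r * radLap (u γ) r)) r := by
  filter_upwards [eventually_scale_lt hE hl hF hμ, eventually_largeHeight (Real.exp 60) lam1,
    hE.eventually_lamBar hl] with γ hscale hlarge hbar
  have hγ1 := hlarge.one_le
  have hγ : 0 < γ := by linarith
  obtain ⟨hβ, hu⟩ := hF γ hγ hbar.1
  obtain ⟨hμ0, hμ4⟩ := hμ γ hγ hbar.1
  obtain ⟨hρ0, hρt⟩ := hρ γ hγ hbar.1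
  obtain ⟨hr1, hr2⟩ := hr' γ hγ hbar.1
  obtain ⟨q, h, hq', hmass⟩ := hu.exists_bubble hγ hbar.1.le hμ0 hμ4
  have hμγ : μ γ * γ ^ 9 ≤ 1 := by
    have := mul_le_mul_of_nonneg_right hscale.le (by positivity : 0 ≤ γ ^ 9)
    rwa [inv_mul_cancel₀ (by positivity)] at this
  have hμ1 : μ γ ≤ 1 := by
    have := le_mul_of_one_le_right hμ0.le (one_le_pow₀ hγ1 : 1 ≤ γ ^ 9)
    linarith
  have hcenter : (γ ^ 2)⁻¹ < β γ * Real.exp (γ ^ 2) := by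
    rw [inv_lt_iff_one_lt_mul₀ (by positivity)]
    have h1 : μ γ ^ 2 ≤ 1 := pow_le_one₀ hμ0.le hμ1
    have h2 : 0 ≤ β γ * γ ^ 2 * Real.exp (γ ^ 2) := by positivity
    have h3 := mul_le_mul_of_nonneg_left h1 h2
    linarith
  have hr'mem : 0 < r' γ ∧ r' γ ≤ 1 ∧
      (γ ^ 2)⁻¹ ≤ β γ * Real.exp ((u γ (r' γ)) ^ 2) := by
    by_cases hcase : β γ < (γ ^ 2)⁻¹ ∧ (γ ^ 2)⁻¹ < β γ * Real.exp (γ ^ 2)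
    · obtain ⟨h1, h2⟩ := hr1 hcase
      exact ⟨h1.1, h1.2.le, h2.ge⟩
    · have h1 := hr2 hcase
      have h2 : (γ ^ 2)⁻¹ ≤ β γ := by
        by_contra! h3
        exact hcase ⟨h3, hcenter⟩
      refine ⟨by rw [h1]; exact one_pos, h1.le, h2.trans (le_mul_of_one_le_right hβ.le ?_)⟩
      exact Real.one_le_exp (sq_nonneg _)
  have hmin : 0 ≤ min (ρ γ) (r' γ) := le_min hρ0.le hr'mem.1.le
  refine ⟨hγ, hbar.1, hmin, q, ?_, hq'⟩
  refine ⟨h, hlarge, Real.one_le_exp (by norm_num), Real.log_exp 60, hμ0,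
    inv_mul_cancel₀ (by positivity), hE.1.le, ?_, hμγ, (min_le_right _ _).trans hr'mem.2.1,
    ?_, ?_⟩
  · exact mul_le_mul_of_nonneg_right hbar.2 (by positivity)
  · rw [← hρt]
    exact tG_mono _ hmin (min_le_left _ _)
  · intro r hr
    have hrr' : r ≤ r' γ := hr.2.trans (min_le_right _ _)
    have h1 : u γ (r' γ) ≤ u γ r := by
      have h2 := le_of_mul_le_mul_left (h.τ_le_τ hr.1 hrr' hr'mem.2.1) hγ
      linarith
    have h0 : 0 ≤ u γ (r' γ) := by
      rcases hr'mem.2.1.lt_or_eq with hlt | heq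
      · exact (hu.2.2.1 _ ⟨hr'mem.1.le, hlt⟩).le
      · rw [heq]; exact hu.2.2.2.1.ge
    have h2 : (γ ^ 2)⁻¹ ≤ β γ * Real.exp (u γ r ^ 2) :=
      hr'mem.2.2.trans (mul_le_mul_of_nonneg_left
        (Real.exp_le_exp.2 (pow_le_pow_left₀ h0 h1 2)) hβ.le)
    have h3 := mul_le_mul_of_nonneg_left h2 (by positivity : 0 ≤ γ ^ 2 * r ^ 2)
    rw [hmass]
    have h4 : γ ^ 2 * r ^ 2 * (γ ^ 2)⁻¹ = r ^ 2 := by field_simp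
    linarith

theorem setIntegral_Ioo_eq_sub {F f : ℝ → ℝ} {a b : ℝ} (hab : a ≤ b)
    (hF : ContinuousOn F (Icc a b)) (hF' : ∀ r ∈ Ioo a b, HasDerivAt F (f r) r)
    (hf : ∀ r ∈ Ioo a b, 0 ≤ f r) : ∫ r in Ioo a b, f r = F b - F a := by
  have hi : IntegrableOn f (Ioc a b) :=
    intervalIntegral.integrableOn_deriv_of_nonneg hF hF' hf
  rw [← integral_Ioc_eq_integral_Ioo, ← intervalIntegral.integral_of_le hab]
  exact intervalIntegral.integral_eq_sub_of_hasDerivAt_of_le hab hF hF'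
    ((intervalIntegrable_iff_integrableOn_Ioc_of_le hab).2 hi)

/-- The integral of the Laplacian over the tail annulus is exponentially small. -/
theorem Bubble.Concentrated.integral_mem_Icc {δ ℓ μ κ γ Λ r₁ R : ℝ} {τ q w : ℝ → ℝ}
    (K : Bubble.Concentrated δ ℓ μ κ γ Λ τ q R) (hr₁ : 0 < r₁) (ht : tG μ r₁ = γ)
    (hq : ∀ r ∈ Ioo (0 : ℝ) 1, HasDerivAt q (γ * (r * w r)) r) :
    ∫ r in Ioo r₁ R, w r * (2 * π * r) ∈ Icc 0
      (2 * π * ((1 + Λ * γ ^ 2) * Bubble.tailConst κ * Real.exp (-γ) * γ ^ 2)) := by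
  have hγ := K.large.one_le
  have hΛ := K.Λ_nonneg
  have hπ := Real.pi_pos
  have hbound : 0 ≤ (1 + Λ * γ ^ 2) * Bubble.tailConst κ * Real.exp (-γ) * γ ^ 2 := by
    unfold Bubble.tailConst
    positivity
  rcases le_total R r₁ with hR | hR
  · rw [Ioo_eq_empty (not_lt.2 hR)]
    simpa using by positivity
  have hs : Ioo r₁ R ⊆ Ioo 0 1 := Ioo_subset_Ioo hr₁.le K.R_le
  have hint : ∫ r in Ioo r₁ R, γ * (r * w r) = q R - q r₁ := by
    refine setIntegral_Ioo_eq_sub hR (K.bubble.q_cont.mono (Icc_subset_Icc hr₁.le K.R_le))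
      (fun r hr => hq r (hs hr)) (fun r hr => ?_)
    have hr0 := hr₁.trans hr.1
    rw [(hq r (hs hr)).unique (K.bubble.q_deriv r (hs hr))]
    exact div_nonneg (mul_nonneg (sub_nonneg.2 (K.bubble.τ_le r (Ioo_subset_Icc_self (hs hr))))
      (add_nonneg (mul_nonneg K.bubble.ℓ_nonneg (sq_nonneg r)) (K.bubble.mass_nonneg r))) hr0.le
  have heq : ∫ r in Ioo r₁ R, w r * (2 * π * r) = 2 * π / γ * (q R - q r₁) := by
    rw [← hint, ← integral_const_mul]
    congr 1 with r
    field_simp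
  have h1 := K.bubble.q_le_q hr₁.le hR K.R_le
  have h2 := (K.tail hr₁ ht hR).q_sub_le.trans K.tail_const_le
  rw [heq]
  have h3 : 2 * π / γ ≤ 2 * π := div_le_self (by positivity) hγ
  exact ⟨mul_nonneg (by positivity) (sub_nonneg.2 h1),
    mul_le_mul h3 h2 (sub_nonneg.2 h1) (by positivity)⟩

/-- There exist C > 0 and γ₀ such that for all γ ≥ γ₀ and r ∈ [0,ρ_γ],
|u_γ(r) − (γ − t_γ(r)/γ)| ≤ C/γ, where ρ_γ = min(ρ_{2,γ}, r'_γ). Moreover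
∫_{B₀(ρ_γ)∖B₀(ρ_{1,γ})} Δu_γ dy = o(γ⁻³). -/
theorem statement9 (lam1 : ℝ) (v1 : ℝ → ℝ) (hE : EigenCtx lam1 v1) (l : ℝ) (hl : 0 < l)
    (β : ℝ → ℝ) (u : ℝ → ℝ → ℝ) (hF : GoodFamily lam1 v1 l β u)
    (μ : ℝ → ℝ)
    (hμ : ∀ γ : ℝ, 0 < γ → 0 < lamBar lam1 (v1 0) l γ →
      0 < μ γ ∧ β γ * γ ^ 2 * Real.exp (γ ^ 2) * (μ γ) ^ 2 = 4)
    (ρ1 ρ2 r' : ℝ → ℝ)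
    (hρ1 : ∀ γ : ℝ, 0 < γ → 0 < lamBar lam1 (v1 0) l γ →
      0 < ρ1 γ ∧ tG (μ γ) (ρ1 γ) = γ)
    (hρ2 : ∀ γ : ℝ, 0 < γ → 0 < lamBar lam1 (v1 0) l γ →
      0 < ρ2 γ ∧ tG (μ γ) (ρ2 γ) = γ ^ 2 - γ)
    (hr' : ∀ γ : ℝ, 0 < γ → 0 < lamBar lam1 (v1 0) l γ →
      ((β γ < (γ ^ 2)⁻¹ ∧ (γ ^ 2)⁻¹ < β γ * Real.exp (γ ^ 2)) →
        r' γ ∈ Set.Ioo (0:ℝ) 1 ∧ β γ * Real.exp ((u γ (r' γ)) ^ 2) = (γ ^ 2)⁻¹) ∧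
      (¬(β γ < (γ ^ 2)⁻¹ ∧ (γ ^ 2)⁻¹ < β γ * Real.exp (γ ^ 2)) → r' γ = 1)) :
    (∃ C : ℝ, 0 < C ∧ ∃ γ0 : ℝ, ∀ γ : ℝ, γ0 ≤ γ →
      ∀ r ∈ Set.Icc (0:ℝ) (min (ρ2 γ) (r' γ)),
        |u γ r - (γ - tG (μ γ) r / γ)| ≤ C / γ) ∧
    Tendsto
      (fun γ : ℝ => γ ^ 3 *
        ∫ r in Set.Ioo (ρ1 γ) (min (ρ2 γ) (r' γ)), radLap (u γ) r * (2 * π * r))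
      atTop (𝓝 0) := by
  have hev := eventually_concentrated hE hl hF hμ hρ2 hr'
  constructor
  · have hκ : (1 : ℝ) ≤ Real.exp 60 := Real.one_le_exp (by norm_num)
    have hC : 0 < Bubble.tailDev (Real.exp 60) + 2 * Bubble.sharpConst (Real.exp 60) := by
      have h1 := Bubble.fluxConst_nonneg hκ
      have h2 := Bubble.sharpConst_nonneg hκ
      unfold Bubble.tailDev
      linarith
    obtain ⟨γ0, hγ0⟩ := eventually_atTop.1 hev
    refine ⟨_, hC, γ0, fun γ hγ r hr => ?_⟩
    obtain ⟨hpos, hbar, -, q, K, -⟩ := hγ0 γ hγ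
    obtain ⟨hρ, ht⟩ := hρ1 γ hpos hbar
    have h1 := (K.mono hr).abs_sub_le hρ ht hr.1
    have h2 : u γ r - (γ - tG (μ γ) r / γ) =
        -((γ * (γ - u γ r) - tG (μ γ) r) / γ) := by
      field_simp
      ring
    rw [h2, abs_neg, abs_div, abs_of_pos hpos]
    exact div_le_div_of_nonneg_right h1 hpos.le
  · have e := Real.tendsto_pow_mul_exp_neg_atTop_nhds_zero
    have hlim : Tendsto (fun γ : ℝ =>
        2 * π * Bubble.tailConst (Real.exp 60) * (γ ^ 5 * Real.exp (-γ)) +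
          2 * π * lam1 * Bubble.tailConst (Real.exp 60) * (γ ^ 7 * Real.exp (-γ)))
        atTop (𝓝 0) := by
      simpa only [mul_zero, add_zero] using
        ((e 5).const_mul (2 * π * Bubble.tailConst (Real.exp 60))).add
          ((e 7).const_mul (2 * π * lam1 * Bubble.tailConst (Real.exp 60)))
    refine squeeze_zero' ?_ ?_ hlim
    all_goals
      filter_upwards [hev] with γ h
      obtain ⟨hpos, hbar, -, q, K, hq⟩ := h
      obtain ⟨hρ, ht⟩ := hρ1 γ hpos hbar
      obtain ⟨h1, h2⟩ := K.integral_mem_Icc hρ ht hq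
    · exact mul_nonneg (by positivity) h1
    · refine (mul_le_mul_of_nonneg_left h2 (by positivity)).trans_eq ?_
      ring

end
end
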